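/- arXiv:0711.0131 — 3 statements merged into one kernel-verified Lean document; each statement's English description precedes it below -/
import Mathlib

section
/- Let H = ℓ²(F₂), A = C*_r(F₂) + K(H), and C ⊆ A the atomic masa generated by the diagonal projections {e_g} and 1. Let β be any C*-norm on A ⊙ A dominating the norm α defined by ‖x‖_α = max(‖x‖_min, ‖π_r(x)‖), where π_r(Σ aᵢ ⊗ bᵢ) = Σ λ(q(aᵢ))ρ(q(bᵢ)) uses the left and right regular representations λ, ρ of C*_r(F₂) and the quotient map q: A → C*_r(F₂). Then C ⊗ C is not maximal abelian in A ⊗_β A. In particular C ⊗ C is not maximal abelian in A ⊗_max A. -/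
set_option maxHeartbeats 1000000
set_option synthInstance.maxHeartbeats 1000000

open scoped ComplexOrder TensorProduct

noncomputable section

/-- A state on a (possibly non-unital) normed star algebra: a norm-one positive
continuous linear functional. -/
def IsState {A : Type*} [NonUnitalNormedRing A] [StarRing A] [NormedSpace ℂ A]
    (φ : A →L[ℂ] ℂ) : Prop :=
  ‖φ‖ = 1 ∧ ∀ a : A, 0 ≤ φ (star a * a)

/-- A pure state: a state which is an extreme point of the state space. -/
def IsPureState {A : Type*} [NonUnitalNormedRing A] [StarRing A] [NormedSpace ℂ A]
    (φ : A →L[ℂ] ℂ) : Prop :=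
  IsState φ ∧ ∀ (ψ₁ ψ₂ : A →L[ℂ] ℂ) (t : ℝ), IsState ψ₁ → IsState ψ₂ → 0 < t → t < 1 →
    φ = (t : ℂ) • ψ₁ + ((1 : ℂ) - (t : ℂ)) • ψ₂ → ψ₁ = φ ∧ ψ₂ = φ

/-- A maximal abelian self-adjoint subalgebra (masa) of a (possibly non-unital)
C*-algebra: an abelian *-subalgebra equal to its own relative commutant. -/
def IsMasa {A : Type*} [NonUnitalCStarAlgebra A] (C : NonUnitalStarSubalgebra ℂ A) : Prop :=
  (∀ x ∈ C, ∀ y ∈ C, x * y = y * x) ∧ ∀ x : A, (∀ c ∈ C, c * x = x * c) → x ∈ C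

/-- A masa of a unital C*-algebra (unital version). -/
def IsMasaU {A : Type*} [CStarAlgebra A] (C : StarSubalgebra ℂ A) : Prop :=
  (∀ x ∈ C, ∀ y ∈ C, x * y = y * x) ∧ ∀ x : A, (∀ c ∈ C, c * x = x * c) → x ∈ C

/-- The Kadison-Singer extension property for a subalgebra of a possibly non-unital
C*-algebra: (i) every pure state (character) of `C` has a unique pure state extension
to `A`, and (ii) no pure state of `A` annihilates `C`. -/
def HasExtensionProperty {A : Type*} [NonUnitalCStarAlgebra A]
    (C : NonUnitalStarSubalgebra ℂ A) : Prop :=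
  (∀ χ : ↥C →L[ℂ] ℂ, IsPureState χ →
      ∃! φ : A →L[ℂ] ℂ, IsPureState φ ∧ ∀ c : ↥C, φ ↑c = χ c) ∧
  ∀ φ : A →L[ℂ] ℂ, IsPureState φ → ∃ c ∈ C, φ c ≠ 0

/-- The extension property for a unital subalgebra of a unital C*-algebra: every pure
state (character) of `C` has a unique pure state extension to `A`. -/
def HasExtensionPropertyU {A : Type*} [CStarAlgebra A] (C : StarSubalgebra ℂ A) : Prop :=
  ∀ χ : ↥C →L[ℂ] ℂ, IsPureState χ →
    ∃! φ : A →L[ℂ] ℂ, IsPureState φ ∧ ∀ c : ↥C, φ ↑c = χ c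

/-- A C*-completion `T` of the algebraic tensor product `A₁ ⊙ A₂` with respect to a
C*-norm `β`: a C*-algebra together with commuting isometric embeddings of the factors
such that the induced map on the algebraic tensor product is injective (i.e. the norm
of `T` restricts to a genuine C*-norm on `A₁ ⊙ A₂`) and has dense range. -/
structure CStarCompletion (A₁ A₂ T : Type*) [NonUnitalCStarAlgebra A₁]
    [NonUnitalCStarAlgebra A₂] [NonUnitalCStarAlgebra T] where
  ι₁ : A₁ →⋆ₙₐ[ℂ] T
  ι₂ : A₂ →⋆ₙₐ[ℂ] T
  isometry₁ : Isometry ι₁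
  isometry₂ : Isometry ι₂
  commutes : ∀ (a : A₁) (b : A₂), ι₁ a * ι₂ b = ι₂ b * ι₁ a
  injective : ∀ (n : ℕ) (a : Fin n → A₁) (b : Fin n → A₂),
      (∑ i, ι₁ (a i) * ι₂ (b i)) = 0 → (∑ i, a i ⊗ₜ[ℂ] b i : A₁ ⊗[ℂ] A₂) = 0
  dense_span : Dense (Submodule.span ℂ {x : T | ∃ a b, x = ι₁ a * ι₂ b} : Set T)

/-- The closure, in a C*-completion `T` of `A₁ ⊙ A₂`, of the linear span of the
elementary tensors `c₁ ⊗ c₂` with `cᵢ` in given subsets of the factors: this is the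
canonical copy of `C₁ ⊗ C₂` inside `A₁ ⊗_β A₂`. -/
def tensorSet {A₁ A₂ T : Type*} [NonUnitalCStarAlgebra A₁] [NonUnitalCStarAlgebra A₂]
    [NonUnitalCStarAlgebra T] (K : CStarCompletion A₁ A₂ T)
    (S₁ : Set A₁) (S₂ : Set A₂) : Set T :=
  closure (Submodule.span ℂ {x : T | ∃ a ∈ S₁, ∃ b ∈ S₂, x = K.ι₁ a * K.ι₂ b} : Set T)

/-- The canonical copy of `C₁ ⊗ C₂` inside `A₁ ⊗_β A₂`, as a closed non-unital
star subalgebra. -/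
def tensorSubalg {A₁ A₂ T : Type*} [NonUnitalCStarAlgebra A₁] [NonUnitalCStarAlgebra A₂]
    [NonUnitalCStarAlgebra T] (K : CStarCompletion A₁ A₂ T)
    (C₁ : NonUnitalStarSubalgebra ℂ A₁) (C₂ : NonUnitalStarSubalgebra ℂ A₂) :
    NonUnitalStarSubalgebra ℂ T :=
  (NonUnitalStarAlgebra.adjoin ℂ
    {x : T | ∃ a ∈ C₁, ∃ b ∈ C₂, x = K.ι₁ a * K.ι₂ b}).topologicalClosure

/-- A (two-sided) bounded approximate identity indexed by a directed set. -/
def IsApproxIdentity {A : Type*} [NonUnitalCStarAlgebra A] {ι : Type}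
    [Preorder ι] (e : ι → A) : Prop :=
  (∀ i, ‖e i‖ ≤ 1) ∧ ∀ a : A,
    Filter.Tendsto (fun i => e i * a) Filter.atTop (nhds a) ∧
    Filter.Tendsto (fun i => a * e i) Filter.atTop (nhds a)

/-- `S` contains a bounded approximate identity for `A`. -/
def ContainsApproxIdentity {A : Type*} [NonUnitalCStarAlgebra A] (S : Set A) : Prop :=
  ∃ (ι : Type) (_ : SemilatticeSup ι) (_ : Nonempty ι) (e : ι → A),
    (∀ i, e i ∈ S) ∧ IsApproxIdentity e

/-! ### Concrete setup: the free group `F₂`, `ℓ²(F₂)` and `B(ℓ²(F₂))` -/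

/-- The free group on two generators. -/
abbrev G2 := FreeGroup (Fin 2)

/-- The Hilbert space `ℓ²(F₂)`. -/
abbrev H2 := lp (fun _ : G2 => ℂ) 2

/-- The canonical orthonormal basis vector `ξ_g` of `ℓ²(F₂)`. -/
def xi (g : G2) : H2 := lp.single 2 g 1

/-- The rank-one operator `e_{g,h} : ξ ↦ ⟨ξ, ξ_h⟩ ξ_g` on `ℓ²(F₂)`; `e_{g,g}` is the
orthogonal projection onto `ℂ ξ_g`. -/
def EE (g h : G2) : H2 →L[ℂ] H2 := (innerSL ℂ (xi h)).smulRight (xi g)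

/-- The reduced group C*-algebra `C*_r(F₂)`: the C*-subalgebra of `B(ℓ²(F₂))` generated
by the left regular representation `lam`. -/
def CrS (lam : G2 → (H2 →L[ℂ] H2)) : StarSubalgebra ℂ (H2 →L[ℂ] H2) :=
  (StarAlgebra.adjoin ℂ (Set.range lam)).topologicalClosure

/-- The C*-algebra `A = C*_r(F₂) + K(ℓ²(F₂))`, as a subset of `B(ℓ²(F₂))`. -/
def Acar (lam : G2 → (H2 →L[ℂ] H2)) : Set (H2 →L[ℂ] H2) :=
  {x | ∃ a ∈ CrS lam, ∃ k : H2 →L[ℂ] H2, IsCompactOperator k ∧ x = a + k}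

/-- The atomic masa `C`: the C*-algebra generated by the diagonal projections
`{e_g : g ∈ F₂}` together with `1`. -/
def CS : StarSubalgebra ℂ (H2 →L[ℂ] H2) :=
  (StarAlgebra.adjoin ℂ (Set.range fun g : G2 => EE g g)).topologicalClosure

/-- `A = C*_r(F₂) + K(ℓ²(F₂))` as a closed non-unital star subalgebra of `B(ℓ²(F₂))`. -/
def ASalg (lam : G2 → (H2 →L[ℂ] H2)) : NonUnitalStarSubalgebra ℂ (H2 →L[ℂ] H2) :=
  (NonUnitalStarAlgebra.adjoin ℂ
    ((CrS lam : Set (H2 →L[ℂ] H2)) ∪ {k | IsCompactOperator k})).topologicalClosure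

instance (lam : G2 → (H2 →L[ℂ] H2)) : IsClosed ((ASalg lam : Set (H2 →L[ℂ] H2))) :=
  NonUnitalStarSubalgebra.isClosed_topologicalClosure _

section MinimalProjection

/-- A nonzero projection `p` with `p T p = ℂ p` gives a representation of `T` on a Hilbert
space completing `T p`. -/
theorem exists_rep_of_minimal_projection.{u} {T : Type u} [NonUnitalCStarAlgebra T] (p : T)
    (hp0 : p ≠ 0) (hps : star p = p) (hpp : p * p = p)
    (hmin : ∀ x : T, ∃ c : ℂ, p * x * p = c • p) :
    ∃ (E : Type u) (_ : NormedAddCommGroup E) (_ : InnerProductSpace ℂ E) (_ : CompleteSpace E)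
      (Ψ : T →⋆ₙₐ[ℂ] (E →L[ℂ] E)) (j : T →ₗ[ℂ] E), DenseRange j ∧ Continuous j ∧
      (∀ x y, Ψ x (j y) = j (x * y)) ∧
      ∀ x y, (inner ℂ (j x) (j y)) • p = p * star x * y * p := by
  let _ : PartialOrder T := CStarAlgebra.spectralOrder T
  have : StarOrderedRing T := CStarAlgebra.spectralOrderedRing T
  choose φ hφ using hmin
  have hinj : ∀ c d : ℂ, c • p = d • p → c = d := fun c d h => smul_left_injective ℂ hp0 h
  let φl : T →ₗ[ℂ] ℂ :=
    { toFun := φ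
      map_add' := fun x y => hinj _ _ (by rw [← hφ, add_smul, ← hφ, ← hφ]; noncomm_ring)
      map_smul' := fun c x => hinj _ _ (by
        rw [← hφ, RingHom.id_apply, smul_eq_mul, mul_smul, ← hφ, mul_smul_comm, smul_mul_assoc]) }
  have hp_nonneg : 0 ≤ p := by
    have := star_mul_self_nonneg p
    rwa [hps, hpp] at this
  have hpos : ∀ x : T, 0 ≤ x → 0 ≤ φl x := by
    intro x hx
    change 0 ≤ φ x
    have h1 : 0 ≤ φ x • p := by
      rw [← hφ]
      have := star_left_conjugate_nonneg hx p
      rwa [hps] at this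
    have hre : starRingEnd ℂ (φ x) = φ x := by
      apply hinj
      have := (IsSelfAdjoint.of_nonneg h1).star_eq
      rwa [star_smul, hps] at this
    obtain ⟨r, hr⟩ := Complex.conj_eq_iff_real.mp hre
    rw [hr] at h1 ⊢
    rw [Complex.zero_le_real]
    by_contra hneg
    push Not at hneg
    have h2 : 0 ≤ (-r) • p := smul_nonneg (by linarith) hp_nonneg
    have h3 : (r : ℂ) • p = -((-r) • p) := by
      rw [neg_smul, neg_neg]; exact Complex.coe_smul r p
    rw [h3] at h1
    have h4 : (-r) • p = 0 := le_antisymm (neg_nonneg.mp h1) h2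
    rcases smul_eq_zero.mp h4 with h | h
    · linarith
    · exact hp0 h
  let f : T →ₚ[ℂ] ℂ := PositiveLinearMap.mk₀ φl hpos
  have hf : ∀ x, f x = φ x := fun _ => rfl
  let j : T →ₗ[ℂ] f.GNS :=
    (UniformSpace.Completion.toComplₗᵢ (𝕜 := ℂ) (E := f.PreGNS)).toLinearMap ∘ₗ
      f.toPreGNS.toLinearMap
  have hj : ∀ x y, (inner ℂ (j x) (j y)) • p = p * star x * y * p := by
    intro x y
    have : inner ℂ (j x) (j y) = f (star x * y) := by
      simp [j, PositiveLinearMap.preGNS_inner_def]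
    rw [this, hf, ← hφ]
    simp only [mul_assoc]
  refine ⟨f.GNS, inferInstance, inferInstance, inferInstance, f.gnsNonUnitalStarAlgHom, j,
    ?_, ?_, ?_, hj⟩
  · exact UniformSpace.Completion.denseRange_coe.comp f.toPreGNS.surjective.denseRange
      (UniformSpace.Completion.continuous_coe _)
  · refine AddMonoidHomClass.continuous_of_bound j ‖p‖ fun x => ?_
    have h1 : ‖j x‖ ^ 2 * ‖p‖ = ‖x * p‖ ^ 2 := by
      have := congrArg norm (hj x x)
      rw [norm_smul, inner_self_eq_norm_sq_to_K, norm_pow, RCLike.norm_ofReal, abs_norm] at this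
      rw [this, sq ‖x * p‖, ← CStarRing.norm_star_mul_self, star_mul, hps]
      simp only [mul_assoc]
    have h2 : ‖p‖ = 1 := by
      have h3 := CStarRing.norm_star_mul_self (x := p)
      rw [hps, hpp] at h3
      exact (mul_left_cancel₀ (norm_ne_zero_iff.mpr hp0) (by rw [mul_one]; exact h3)).symm
    rw [h2, mul_one] at h1
    have h4 : ‖j x‖ = ‖x * p‖ := by
      rwa [sq_eq_sq₀ (norm_nonneg _) (norm_nonneg _)] at h1
    rw [h4, mul_comm]
    exact norm_mul_le _ _
  · intro x y
    simp [j]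

/-- A quantitative form of the paradoxical argument: if `A` (resp. `B`) maps the complement
of `K 1` into `K 0` (resp. of `K 3` into `K 2`), no vector is almost invariant. -/
theorem norm_sq_add_le_of_paradoxical {E : Type*} [NormedAddCommGroup E] [InnerProductSpace ℂ E]
    [CompleteSpace E] (K : Fin 4 → Submodule ℂ E) [∀ i, CompleteSpace (K i)]
    (hK : ∀ i k, i ≠ k → K i ⟂ K k)
    (A B : E →L[ℂ] E) (hA : ∀ v, ‖A v‖ = ‖v‖) (hB : ∀ v, ‖B v‖ = ‖v‖)
    (hAK : ∀ v ∈ (K 1)ᗮ, A v ∈ K 0) (hBK : ∀ v ∈ (K 3)ᗮ, B v ∈ K 2) (v : E) :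
    ‖v + A v + B v‖ ^ 2 ≤ (9 - 1 / 8) * ‖v‖ ^ 2 := by
  have key : ∀ (K₀ K₁ : Submodule ℂ E) [CompleteSpace K₀] [CompleteSpace K₁] (C : E →L[ℂ] E),
      (∀ v, ‖C v‖ = ‖v‖) → (∀ v ∈ K₁ᗮ, C v ∈ K₀) →
      ‖v‖ ^ 2 - ‖K₀.starProjection v‖ ^ 2 ≤
        ‖K₁.starProjection v‖ ^ 2 + 2 * ‖v - C v‖ * ‖v‖ := by
    intro K₀ K₁ _ _ C hC hCK
    have hsq := K₀.norm_sq_eq_add_norm_sq_starProjection v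
    have h0 : K₀ᗮ.starProjection (C (v - K₁.starProjection v)) = 0 := by
      rw [Submodule.starProjection_apply_eq_zero_iff]
      rw [Submodule.orthogonal_orthogonal]
      exact hCK _ (K₁.sub_starProjection_mem_orthogonal v)
    have h1 : K₀ᗮ.starProjection v =
        K₀ᗮ.starProjection (v - C v) + K₀ᗮ.starProjection (C (K₁.starProjection v)) := by
      rw [map_sub, map_sub] at h0
      rw [map_sub]
      rw [sub_eq_zero] at h0
      rw [h0]; abel
    have h2 : ‖K₀ᗮ.starProjection v‖ ≤ ‖v - C v‖ + ‖K₁.starProjection v‖ := by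
      rw [h1]
      refine (norm_add_le _ _).trans (add_le_add (Submodule.norm_starProjection_apply_le _ _) ?_)
      exact (Submodule.norm_starProjection_apply_le _ _).trans (hC _).le
    have h3 : ‖K₀ᗮ.starProjection v‖ ≤ ‖v‖ := Submodule.norm_starProjection_apply_le _ _
    have h4 : ‖K₁.starProjection v‖ ≤ ‖v‖ := Submodule.norm_starProjection_apply_le _ _
    have h5 := norm_nonneg (K₀ᗮ.starProjection v)
    have h6 := norm_nonneg (v - C v)
    have h7 := norm_nonneg (K₁.starProjection v)
    nlinarith [mul_nonneg h6 (sub_nonneg.mpr h3), mul_nonneg h6 (sub_nonneg.mpr h4),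
      mul_nonneg h5 (sub_nonneg.mpr h2), mul_nonneg h7 (sub_nonneg.mpr h2)]
  have hbessel : ∑ i, ‖(K i).starProjection v‖ ^ 2 ≤ ‖v‖ ^ 2 := by
    set s := ∑ i, (K i).starProjection v with hs
    have hss : ‖s‖ ^ 2 = ∑ i, ‖(K i).starProjection v‖ ^ 2 := by
      have hpw : ∀ i k, i ≠ k →
          inner ℂ ((K i).starProjection v) ((K k).starProjection v) = 0 := fun i k hik =>
        (hK i k hik).inner_eq (Submodule.starProjection_apply_mem _ _)
          (Submodule.starProjection_apply_mem _ _)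
      have : (inner ℂ s s) = ∑ i, ((‖(K i).starProjection v‖ : ℂ) ^ 2) := by
        rw [hs, sum_inner]
        refine Finset.sum_congr rfl fun i _ => ?_
        rw [inner_sum, Finset.sum_eq_single i]
        · exact inner_self_eq_norm_sq_to_K _
        · exact fun k _ hki => hpw i k hki.symm
        · simp
      rw [inner_self_eq_norm_sq_to_K] at this
      apply Complex.ofReal_injective
      push_cast
      exact this
    have hsv : inner ℂ v s = (‖s‖ ^ 2 : ℂ) := by
      have h : (‖s‖ ^ 2 : ℂ) = ∑ i, ((‖(K i).starProjection v‖ : ℂ) ^ 2) := by exact_mod_cast hss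
      rw [h, hs, inner_sum]
      refine Finset.sum_congr rfl fun i _ => ?_
      have := (K i).inner_starProjection_left_eq_right v ((K i).starProjection v)
      rw [show (K i).starProjection ((K i).starProjection v) = (K i).starProjection v from
        Submodule.starProjection_eq_self_iff.mpr (Submodule.starProjection_apply_mem _ _)] at this
      rw [← this]
      exact inner_self_eq_norm_sq_to_K _
    have hle : ‖s‖ ^ 2 ≤ ‖v‖ * ‖s‖ := by
      have := norm_inner_le_norm (𝕜 := ℂ) v s
      rw [hsv] at this
      simpa using this
    rw [← hss]
    have h1 := norm_nonneg s
    have h2 := norm_nonneg v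
    have : ‖s‖ ≤ ‖v‖ := by
      by_contra hlt
      push Not at hlt
      nlinarith
    nlinarith
  have h1 := key (K 0) (K 1) A hA hAK
  have h2 := key (K 2) (K 3) B hB hBK
  simp only [Fin.sum_univ_four] at hbessel
  have hpar : ‖v + A v + B v‖ ^ 2 + ‖v - A v‖ ^ 2 + ‖v - B v‖ ^ 2 + ‖A v - B v‖ ^ 2
      = 9 * ‖v‖ ^ 2 := by
    have e1 := norm_add_sq (𝕜 := ℂ) (v + A v) (B v)
    have e2 := norm_add_sq (𝕜 := ℂ) v (A v)
    have e3 := norm_sub_sq (𝕜 := ℂ) v (A v)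
    have e4 := norm_sub_sq (𝕜 := ℂ) v (B v)
    have e5 := norm_sub_sq (𝕜 := ℂ) (A v) (B v)
    rw [inner_add_left, map_add] at e1
    rw [hA, hB] at *
    linarith
  have hv := norm_nonneg v
  have ha := norm_nonneg (v - A v)
  have hb := norm_nonneg (v - B v)
  have hsum : ‖v‖ ^ 2 ≤ 2 * (‖v - A v‖ + ‖v - B v‖) * ‖v‖ := by nlinarith
  have hsum' : ‖v‖ ≤ 2 * (‖v - A v‖ + ‖v - B v‖) := by
    rcases hv.eq_or_lt with h | h
    · rw [← h]; positivity
    · nlinarith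
  nlinarith [sq_nonneg (‖v - A v‖ - ‖v - B v‖), sq_nonneg ‖A v - B v‖]

theorem norm_sq_add_freeGroup_le {E : Type*} [NormedAddCommGroup E] [InnerProductSpace ℂ E]
    [CompleteSpace E] (b : HilbertBasis (G2 × G2) ℂ E) (A B : E →L[ℂ] E)
    (hA : ∀ v, ‖A v‖ = ‖v‖) (hB : ∀ v, ‖B v‖ = ‖v‖)
    (hAb : ∀ g h, A (b (g, h)) = b (FreeGroup.of 0 * g, FreeGroup.of 0 * h))
    (hBb : ∀ g h, B (b (g, h)) = b (FreeGroup.of 1 * g, FreeGroup.of 1 * h)) (v : E) :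
    ‖v + A v + B v‖ ^ 2 ≤ (9 - 1 / 8) * ‖v‖ ^ 2 := by
  let W : Fin 2 × Bool → Set G2 := FreeGroup.startsWith
  let K : Fin 2 × Bool → Submodule ℂ E := fun w =>
    (Submodule.span ℂ (b '' {x | x.1 ∉ W w}))ᗮ
  have memK : ∀ w (u : E), u ∈ K w ↔ ∀ x : G2 × G2, x.1 ∉ W w → inner ℂ (b x) u = 0 := by
    intro w u
    refine ⟨fun hu x hx => hu _ (Submodule.subset_span ⟨x, hx, rfl⟩), fun hu y hy => ?_⟩
    induction hy using Submodule.span_induction with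
    | mem y hy => obtain ⟨x, hx, rfl⟩ := hy; exact hu x hx
    | zero => simp
    | add y z _ _ h1 h2 => rw [inner_add_left, h1, h2, add_zero]
    | smul c y _ h1 => rw [inner_smul_left, h1, mul_zero]
  have hK : ∀ w w', w ≠ w' → K w ⟂ K w' := by
    intro w w' hne
    rw [Submodule.isOrtho_iff_inner_eq]
    intro u hu u' hu'
    rw [← b.tsum_inner_mul_inner u u']
    refine (tsum_congr fun x => ?_).trans tsum_zero
    by_cases hx : x.1 ∈ W w
    · have hx' : x.1 ∉ W w' := Set.disjoint_left.mp
        (FreeGroup.startsWith.disjoint_iff_ne.mpr hne) hx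
      rw [(memK w' u').mp hu' x hx', mul_zero]
    · rw [← inner_conj_symm, (memK w u).mp hu x hx, map_zero, zero_mul]
  have hmap : ∀ (i : Fin 2) (C : E →L[ℂ] E), (∀ v, ‖C v‖ = ‖v‖) →
      (∀ g h, C (b (g, h)) = b (FreeGroup.of i * g, FreeGroup.of i * h)) →
      ∀ u ∈ (K (i, false))ᗮ, C u ∈ K (i, true) := by
    intro i C hC hCb u hu
    rw [memK]
    rintro ⟨g, h⟩ hg
    have h1 : b (g, h) = C (b ((FreeGroup.of i)⁻¹ * g, (FreeGroup.of i)⁻¹ * h)) := by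
      rw [hCb, mul_inv_cancel_left, mul_inv_cancel_left]
    have h2 : ∀ y z, inner ℂ (C y) (C z) = inner ℂ y z :=
      (⟨C.toLinearMap, hC⟩ : E →ₗᵢ[ℂ] E).inner_map_map
    rw [h1, h2]
    apply hu
    rw [memK]
    rintro ⟨g', h'⟩ hg'
    apply b.orthonormal.2
    rintro heq
    apply hg'
    rw [Prod.mk.injEq] at heq
    have h3 : (FreeGroup.of i)⁻¹ * g ∈ FreeGroup.startsWith (i, false) :=
      FreeGroup.startsWith_mk_mul (w := (i, false)) g (by simpa using hg)
    rw [heq.1]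
    exact h3
  refine norm_sq_add_le_of_paradoxical
    (fun i : Fin 4 => K (![(0, true), (0, false), (1, true), (1, false)] i)) ?_ A B hA hB
    (hmap 0 A hA hAb) (hmap 1 B hB hBb) v
  intro i k hik
  apply hK
  revert i k
  decide

/-! ### The algebra `A` -/

theorem orthonormal_xi : Orthonormal ℂ xi := by
  classical
  rw [orthonormal_iff_ite]
  intro g h
  simp only [xi]
  rw [lp.inner_single_left, lp.single_apply, Pi.single_apply]
  simp

theorem H2_clm_ext {F : Type*} [NormedAddCommGroup F] [NormedSpace ℂ F] {f f' : H2 →L[ℂ] F}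
    (h : ∀ g, f (xi g) = f' (xi g)) : f = f' := by
  refine lp.ext_continuousLinearMap (by simp) fun g => ?_
  ext
  exact h g

theorem mem_of_forall_xi_mem {S : Submodule ℂ H2} (hS : IsClosed (S : Set H2))
    (h : ∀ g, xi g ∈ S) (η : H2) : η ∈ S := by
  refine hS.mem_of_tendsto (lp.hasSum_single (by simp) η) (Filter.Eventually.of_forall fun s => ?_)
  refine S.sum_mem fun g _ => ?_
  have : lp.single 2 g (η g) = (η g) • xi g := by
    rw [xi, ← lp.single_smul, smul_eq_mul, mul_one]
  rw [this]
  exact S.smul_mem _ (h g)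

/-- The rank-one operator `ξ ↦ ⟨ξ, ξ_h⟩ η`. -/
def rankOne (h : G2) (η : H2) : H2 →L[ℂ] H2 := (innerSL ℂ (xi h)).smulRight η

theorem rankOne_apply (h : G2) (η ζ : H2) : rankOne h η ζ = inner ℂ (xi h) ζ • η := rfl

theorem rankOne_isCompact (h : G2) (η : H2) : IsCompactOperator (rankOne h η) := by
  have h1 : IsCompactOperator (id : ℂ → ℂ) := isCompactOperator_id
  exact (h1.comp_clm (innerSL ℂ (xi h))).clm_comp ((ContinuousLinearMap.id ℂ ℂ).smulRight η)

variable {lam : G2 → (H2 →L[ℂ] H2)}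

theorem mem_ASalg_of_isCompact {k : H2 →L[ℂ] H2} (hk : IsCompactOperator k) : k ∈ ASalg lam :=
  subset_closure (NonUnitalStarAlgebra.subset_adjoin ℂ _ (Or.inr hk))

theorem mem_ASalg_of_mem_CrS {k : H2 →L[ℂ] H2} (hk : k ∈ CrS lam) : k ∈ ASalg lam :=
  subset_closure (NonUnitalStarAlgebra.subset_adjoin ℂ _ (Or.inl hk))

theorem lam_mem_CrS (g : G2) : lam g ∈ CrS lam :=
  subset_closure (StarAlgebra.subset_adjoin ℂ _ ⟨g, rfl⟩)

variable (lam) in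
/-- `rankOne` as an element of `A`. -/
def rk (h : G2) (η : H2) : ASalg lam :=
  ⟨rankOne h η, mem_ASalg_of_isCompact (rankOne_isCompact h η)⟩

variable (lam) in
/-- The unit of `A`. -/
def oneA : ASalg lam := ⟨1, mem_ASalg_of_mem_CrS (one_mem _)⟩

variable (lam) in
/-- The translation `λ(g)` as an element of `A`. -/
def lamA (g : G2) : ASalg lam := ⟨lam g, mem_ASalg_of_mem_CrS (lam_mem_CrS g)⟩

theorem oneA_mul (a : ASalg lam) : oneA lam * a = a := Subtype.ext (one_mul _)

theorem mul_rk (a : ASalg lam) (h : G2) (η : H2) :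
    a * rk lam h η = rk lam h ((a : H2 →L[ℂ] H2) η) := by
  apply Subtype.ext
  ext1 ζ
  change (a : H2 →L[ℂ] H2) (rankOne h η ζ) = rankOne h _ ζ
  rw [rankOne_apply, rankOne_apply, map_smul]

theorem rk_smul (h : G2) (c : ℂ) (η : H2) : rk lam h (c • η) = c • rk lam h η := by
  apply Subtype.ext
  ext1 ζ
  exact smul_comm (inner ℂ (xi h) ζ) c η

theorem rk_add (h : G2) (η η' : H2) : rk lam h (η + η') = rk lam h η + rk lam h η' := by
  apply Subtype.ext
  ext1 ζ
  exact smul_add (inner ℂ (xi h) ζ) η η'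

theorem rk_apply_xi (h k : G2) (η : H2) :
    (rk lam h η : H2 →L[ℂ] H2) (xi k) = (if h = k then (1 : ℂ) else 0) • η := by
  change rankOne h η (xi k) = _
  rw [rankOne_apply, orthonormal_iff_ite.mp orthonormal_xi]

theorem rk_mul_rk (h k : G2) (η : H2) (g : G2) :
    rk lam h η * rk lam k (xi g) = (if h = g then (1 : ℂ) else 0) • rk lam k η := by
  rw [mul_rk, rk_apply_xi, rk_smul]

theorem star_rk (g h : G2) : star (rk lam h (xi g)) = rk lam g (xi h) := by
  apply Subtype.ext
  change star (rankOne h (xi g)) = rankOne g (xi h)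
  rw [ContinuousLinearMap.star_eq_adjoint]
  symm
  rw [ContinuousLinearMap.eq_adjoint_iff]
  intro x y
  rw [rankOne_apply, rankOne_apply, inner_smul_left, inner_smul_right, inner_conj_symm]
  ring

theorem rk_xi_ne_zero (g h : G2) : rk lam h (xi g) ≠ 0 := by
  intro h0
  have := rk_apply_xi (lam := lam) h h (xi g)
  rw [h0] at this
  simp only [if_true, one_smul] at this
  exact (orthonormal_xi.ne_zero g) this.symm

theorem norm_rk_le (h : G2) (η : H2) : ‖rk lam h η‖ ≤ ‖η‖ := by
  change ‖rankOne h η‖ ≤ _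
  rw [rankOne, ContinuousLinearMap.norm_smulRight_apply, innerSL_apply_norm, orthonormal_xi.1,
    one_mul]

variable (lam) in
/-- `rk` as a continuous linear map in the vector. -/
def rkL (h : G2) : H2 →L[ℂ] ASalg lam :=
  LinearMap.mkContinuous
    { toFun := rk lam h
      map_add' := rk_add h
      map_smul' := rk_smul h } 1 fun η => by rw [one_mul]; exact norm_rk_le h η

theorem rk_mul_mul_rk (g h : G2) (a : ASalg lam) :
    ∃ c : ℂ, rk lam g (xi h) * a * rk lam g (xi h) = c • rk lam g (xi h) := by
  refine ⟨inner ℂ (xi g) ((a : H2 →L[ℂ] H2) (xi h)), ?_⟩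
  rw [mul_assoc, mul_rk, mul_rk, ← rk_smul]
  rfl

theorem eq_zero_of_mul_rk (a : ASalg lam) (k : G2) (h : ∀ g, a * rk lam k (xi g) = 0) : a = 0 := by
  apply Subtype.ext
  apply H2_clm_ext
  intro g
  have := h g
  rw [mul_rk] at this
  have h1 := rk_apply_xi (lam := lam) k k ((a : H2 →L[ℂ] H2) (xi g))
  rw [this, if_pos rfl, one_smul] at h1
  exact h1.symm

theorem inner_xi (k : G2) (η : H2) : inner ℂ (xi k) η = η k := by
  rw [xi, lp.inner_single_left]
  simp

theorem star_lamA_mul (hlam : ∀ g h : G2, lam g (xi h) = xi (g * h)) (g : G2) :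
    star (lamA lam g) * lamA lam g = oneA lam := by
  apply Subtype.ext
  change star (lam g) * lam g = 1
  apply H2_clm_ext
  intro h
  ext k
  rw [← inner_xi, ← inner_xi]
  change inner ℂ (xi k) (star (lam g) (lam g (xi h))) = inner ℂ (xi k) (xi h)
  rw [ContinuousLinearMap.star_eq_adjoint, ContinuousLinearMap.adjoint_inner_right, hlam, hlam,
    orthonormal_iff_ite.mp orthonormal_xi, orthonormal_iff_ite.mp orthonormal_xi]
  simp

theorem lamA_one (hlam : ∀ g h : G2, lam g (xi h) = xi (g * h)) : lamA lam 1 = oneA lam := by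
  apply Subtype.ext
  apply H2_clm_ext
  intro h
  change lam 1 (xi h) = xi h
  rw [hlam, one_mul]

theorem lamA_mul_rk (hlam : ∀ g h : G2, lam g (xi h) = xi (g * h)) (g h k : G2) :
    lamA lam g * rk lam k (xi h) = rk lam k (xi (g * h)) := by
  rw [mul_rk]
  congr 1
  exact hlam g h

/-! ### Completions of the algebraic tensor product -/

namespace CStarCompletion

variable {A₁ A₂ T : Type*} [NonUnitalCStarAlgebra A₁] [NonUnitalCStarAlgebra A₂]
  [NonUnitalCStarAlgebra T] (K : CStarCompletion A₁ A₂ T)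

/-- The elementary tensor `a ⊗ b`. -/
def tm (a : A₁) (b : A₂) : T := K.ι₁ a * K.ι₂ b

theorem tm_mul_tm (a c : A₁) (b d : A₂) : K.tm a b * K.tm c d = K.tm (a * c) (b * d) := by
  simp only [tm, map_mul]
  rw [mul_assoc, ← mul_assoc (K.ι₂ b), ← K.commutes c b]
  simp only [mul_assoc]

theorem star_tm (a : A₁) (b : A₂) : star (K.tm a b) = K.tm (star a) (star b) := by
  simp only [tm, star_mul, map_star]
  rw [← map_star, ← map_star, K.commutes]

theorem tm_smul_left (c : ℂ) (a : A₁) (b : A₂) : K.tm (c • a) b = c • K.tm a b := by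
  simp only [tm, map_smul, smul_mul_assoc]

theorem tm_smul_right (c : ℂ) (a : A₁) (b : A₂) : K.tm a (c • b) = c • K.tm a b := by
  simp only [tm, map_smul, mul_smul_comm]

theorem tm_zero_right (a : A₁) : K.tm a 0 = 0 := by rw [tm, map_zero, mul_zero]

theorem induction {S : Submodule ℂ T} (hS : IsClosed (S : Set T)) (h : ∀ a b, K.tm a b ∈ S)
    (y : T) : y ∈ S := by
  have h1 : Submodule.span ℂ {x : T | ∃ a b, x = K.ι₁ a * K.ι₂ b} ≤ S := by
    rw [Submodule.span_le]
    rintro _ ⟨a, b, rfl⟩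
    exact h a b
  exact (closure_minimal (SetLike.coe_subset_coe.mpr h1) hS) (K.dense_span y)

/-- The flipped completion. -/
def flip : CStarCompletion A₂ A₁ T where
  ι₁ := K.ι₂
  ι₂ := K.ι₁
  isometry₁ := K.isometry₂
  isometry₂ := K.isometry₁
  commutes a b := (K.commutes b a).symm
  injective n a b h := by
    have h1 := K.injective n b a (by
      rw [← h]
      exact Finset.sum_congr rfl fun i _ => K.commutes _ _)
    simpa using congrArg (TensorProduct.comm ℂ A₁ A₂) h1
  dense_span := by
    convert K.dense_span using 4
    ext x
    constructor
    · rintro ⟨a, b, rfl⟩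
      exact ⟨b, a, (K.commutes b a).symm⟩
    · rintro ⟨a, b, rfl⟩
      exact ⟨b, a, K.commutes a b⟩

theorem flip_tm (a : A₁) (b : A₂) : K.flip.tm b a = K.tm a b := (K.commutes a b).symm

theorem eq_zero_of_tm_eq_zero {a : A₁} (ha : a ≠ 0) {b : A₂} (h : K.tm a b = 0) : b = 0 := by
  have h1 : (a ⊗ₜ[ℂ] b : A₁ ⊗[ℂ] A₂) = 0 := by
    simpa using K.injective 1 (fun _ => a) (fun _ => b) (by simpa [tm] using h)
  obtain ⟨f, hf⟩ : ∃ f : Module.Dual ℂ A₁, f a ≠ 0 := by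
    by_contra! hf
    exact ha ((Module.forall_dual_apply_eq_zero_iff ℂ a).mp hf)
  have h2 := congrArg (fun z => TensorProduct.lid ℂ A₂ (f.rTensor A₂ z)) h1
  simp only [LinearMap.rTensor_tmul, TensorProduct.lid_tmul, map_zero] at h2
  exact (smul_eq_zero.mp h2).resolve_left hf

theorem isClosed_range_tm {a : A₁} (ha : a ≠ 0) (has : star a = a) (haa : a * a = a) :
    IsClosed (Set.range (K.tm a)) := by
  let Φ : A₂ →⋆ₙₐ[ℂ] T :=
    { toFun := K.tm a
      map_smul' := fun c b => K.tm_smul_right c a b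
      map_zero' := K.tm_zero_right a
      map_add' := fun b c => by simp only [tm, map_add, mul_add]
      map_mul' := fun b c => by rw [tm_mul_tm, haa]
      map_star' := fun b => by rw [star_tm, has] }
  have hinj : Function.Injective Φ := (injective_iff_map_eq_zero Φ).mpr fun b hb =>
    K.eq_zero_of_tm_eq_zero ha hb
  have hiso : Isometry Φ :=
    AddMonoidHomClass.isometry_of_norm Φ (NonUnitalStarAlgHom.norm_map Φ hinj)
  exact hiso.isClosedEmbedding.isClosed_range

theorem ι_one_mul {e : A₁} (he : ∀ a, e * a = a) (x : T) : K.ι₁ e * x = x := by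
  let S : Submodule ℂ T := LinearMap.eqLocus (LinearMap.mulLeft ℂ (K.ι₁ e)) LinearMap.id
  have hS : IsClosed (S : Set T) :=
    isClosed_eq (f := fun x => K.ι₁ e * x) (g := fun x => x) (by fun_prop) (by fun_prop)
  refine K.induction (S := S) hS (fun a b => ?_) x
  change K.ι₁ e * (K.ι₁ a * K.ι₂ b) = K.ι₁ a * K.ι₂ b
  rw [← mul_assoc, ← map_mul, he]

end CStarCompletion

section Kernel

variable {T : Type*} [NonUnitalCStarAlgebra T] (K : CStarCompletion (ASalg lam) (ASalg lam) T)

/-- The minimal projection `e₁₁ ⊗ e₁₁`. -/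
def minProj : T := K.tm (rk lam 1 (xi 1)) (rk lam 1 (xi 1))

theorem tm_mul_minProj (a b : ASalg lam) : K.tm a b * minProj K =
    K.tm (rk lam 1 ((a : H2 →L[ℂ] H2) (xi 1))) (rk lam 1 ((b : H2 →L[ℂ] H2) (xi 1))) := by
  rw [minProj, K.tm_mul_tm, mul_rk, mul_rk]

theorem tm_rk_mul_minProj (η ζ : H2) : K.tm (rk lam 1 η) (rk lam 1 ζ) * minProj K =
    K.tm (rk lam 1 η) (rk lam 1 ζ) := by
  rw [tm_mul_minProj, rk_apply_xi, rk_apply_xi, if_pos rfl, one_smul, one_smul]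

theorem minProj_mul_self : minProj K * minProj K = minProj K := tm_rk_mul_minProj K _ _

theorem star_minProj : star (minProj K) = minProj K := by
  rw [minProj, K.star_tm, star_rk]

theorem minProj_ne_zero : minProj K ≠ 0 := fun h =>
  rk_xi_ne_zero 1 1 (K.eq_zero_of_tm_eq_zero (rk_xi_ne_zero 1 1) h)

theorem minProj_mul_mul (x : T) : ∃ c : ℂ, minProj K * x * minProj K = c • minProj K := by
  let S : Submodule ℂ T := (Submodule.span ℂ {minProj K}).comap
    (LinearMap.mulRight ℂ (minProj K) ∘ₗ LinearMap.mulLeft ℂ (minProj K))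
  have hS : IsClosed (S : Set T) :=
    (Submodule.closed_of_finiteDimensional (Submodule.span ℂ {minProj K})).preimage
      (f := fun x => minProj K * x * minProj K) (by fun_prop)
  have := K.induction (S := S) hS (fun a b => ?_) x
  · obtain ⟨c, hc⟩ := Submodule.mem_span_singleton.mp this
    exact ⟨c, hc.symm⟩
  · change minProj K * K.tm a b * minProj K ∈ Submodule.span ℂ {minProj K}
    rw [minProj, K.tm_mul_tm, K.tm_mul_tm]
    obtain ⟨c, hc⟩ := rk_mul_mul_rk 1 1 a
    obtain ⟨d, hd⟩ := rk_mul_mul_rk 1 1 b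
    rw [hc, hd, K.tm_smul_left, K.tm_smul_right]
    exact Submodule.smul_mem _ _ (Submodule.smul_mem _ _ (Submodule.mem_span_singleton_self _))

theorem mul_ι_rk_eq_zero {x : T} (hx : ∀ y, x * y * minProj K = 0) (g : G2) :
    x * K.ι₁ (rk lam g (xi g)) = 0 := by
  set e := rk lam g (xi g) with he
  have hes : star e = e := star_rk g g
  have hee : e * e = e := by rw [he, rk_mul_rk, if_pos rfl, one_smul]
  have hιs : star (K.ι₁ e) = K.ι₁ e := by rw [← map_star, hes]
  rw [← CStarRing.star_mul_self_eq_zero_iff, star_mul, hιs]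
  let S : Submodule ℂ T := (LinearMap.range (LinearMap.mulLeft ℂ (K.ι₁ e) ∘ₗ
    (K.ι₂ : ASalg lam →ₗ[ℂ] T))).comap
      (LinearMap.mulRight ℂ (K.ι₁ e) ∘ₗ LinearMap.mulLeft ℂ (K.ι₁ e))
  have hS : IsClosed (S : Set T) :=
    (K.isClosed_range_tm (rk_xi_ne_zero g g) hes hee).preimage
      (f := fun x => K.ι₁ e * x * K.ι₁ e) (by fun_prop)
  obtain ⟨b, hb⟩ : ∃ b, K.tm e b = K.ι₁ e * (star x * x) * K.ι₁ e := by
    refine K.induction (S := S) hS (fun a b => ?_) (star x * x)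
    obtain ⟨c, hc⟩ := rk_mul_mul_rk g g a
    refine ⟨c • b, ?_⟩
    change K.tm e (c • b) = K.ι₁ e * (K.ι₁ a * K.ι₂ b) * K.ι₁ e
    rw [K.tm_smul_right, ← K.tm_smul_left, ← hc, ← he, CStarCompletion.tm, map_mul, map_mul]
    simp only [mul_assoc, ← K.commutes e b]
  have hb0 : b = 0 := by
    refine eq_zero_of_mul_rk b 1 fun h => ?_
    refine K.eq_zero_of_tm_eq_zero (rk_xi_ne_zero g 1) ?_
    have h1 : K.tm e b * K.tm (rk lam 1 (xi g)) (rk lam 1 (xi h)) = 0 := by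
      rw [hb, ← tm_rk_mul_minProj]
      have := hx (K.ι₁ e * K.tm (rk lam 1 (xi g)) (rk lam 1 (xi h)))
      simp only [mul_assoc] at this ⊢
      rw [this, mul_zero, mul_zero]
    rwa [K.tm_mul_tm, he, rk_mul_rk, if_pos rfl, one_smul] at h1
  have hz : K.tm e b = 0 := by
    rw [hb0]
    exact K.tm_zero_right e
  calc K.ι₁ e * star x * (x * K.ι₁ e) = K.ι₁ e * (star x * x) * K.ι₁ e := by
        simp only [mul_assoc]
    _ = 0 := hb.symm.trans hz

theorem mul_ι_rk_eq_zero' {x : T} (hx : ∀ y, x * y * minProj K = 0) (g : G2) :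
    x * K.ι₂ (rk lam g (xi g)) = 0 := by
  refine mul_ι_rk_eq_zero K.flip (fun y => ?_) g
  rw [minProj, K.flip_tm]
  exact hx y

theorem tm_oneA_mul (x : T) : K.tm (oneA lam) (oneA lam) * x = x := by
  have h : K.ι₂ (oneA lam) * x = x := K.flip.ι_one_mul (e := oneA lam) oneA_mul x
  rw [CStarCompletion.tm, mul_assoc, h, K.ι_one_mul oneA_mul]

/-- The diagonal element `λ(g) ⊗ λ(g)`. -/
def diagLam (g : G2) : T := K.tm (lamA lam g) (lamA lam g)

theorem star_diagLam_mul (hlam : ∀ g h : G2, lam g (xi h) = xi (g * h)) (g : G2) (x : T) :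
    star (diagLam K g) * (diagLam K g * x) = x := by
  rw [← mul_assoc, diagLam, K.star_tm, K.tm_mul_tm, star_lamA_mul hlam, tm_oneA_mul]

/-- If the representation on `T p` is faithful, then `1 ⊗ 1 + λ(a) ⊗ λ(a) + λ(b) ⊗ λ(b)`
has norm less than `3`. -/
theorem norm_diagLam_sum_lt (hlam : ∀ g h : G2, lam g (xi h) = xi (g * h))
    (hK : ∀ x : T, (∀ y, x * y * minProj K = 0) → x = 0) :
    ‖diagLam K 1 + diagLam K (FreeGroup.of 0) + diagLam K (FreeGroup.of 1)‖ < 3 := by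
  obtain ⟨E, _, _, _, Ψ, j, hjd, hjc, hΨ, hj⟩ := exists_rep_of_minimal_projection (minProj K)
    (minProj_ne_zero K) (star_minProj K) (minProj_mul_self K) (minProj_mul_mul K)
  have hinj_smul : ∀ c d : ℂ, c • minProj K = d • minProj K → c = d := fun c d h =>
    smul_left_injective ℂ (minProj_ne_zero K) h
  have hj0 : ∀ x, x * minProj K = 0 ↔ j x = 0 := by
    intro x
    have h1 : (inner ℂ (j x) (j x)) • minProj K = star (x * minProj K) * (x * minProj K) := by
      rw [hj, star_mul, star_minProj]
      simp only [mul_assoc]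
    rw [← CStarRing.star_mul_self_eq_zero_iff, ← h1, smul_eq_zero,
      or_iff_left (minProj_ne_zero K), inner_self_eq_zero]
  have hinj : Function.Injective Ψ := (injective_iff_map_eq_zero Ψ).mpr fun x hx => by
    refine hK x fun y => ?_
    rw [hj0, ← hΨ, hx]
    rfl
  rw [← NonUnitalStarAlgHom.norm_map Ψ hinj, map_add, map_add]
  -- the orthonormal basis
  let o : G2 × G2 → E := fun x => j (K.tm (rk lam 1 (xi x.1)) (rk lam 1 (xi x.2)))
  have ho : Orthonormal ℂ o := by
    classical
    rw [orthonormal_iff_ite]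
    rintro ⟨g, h⟩ ⟨g', h'⟩
    apply hinj_smul
    rw [hj, mul_assoc (minProj K), K.star_tm, K.tm_mul_tm, star_rk, star_rk, rk_mul_rk, rk_mul_rk,
      K.tm_smul_left, K.tm_smul_right, smul_smul, mul_smul_comm, smul_mul_assoc]
    change _ • (minProj K * minProj K * minProj K) = _
    rw [minProj_mul_self, minProj_mul_self]
    congr 1
    by_cases h1 : g = g' <;> by_cases h2 : h = h' <;> simp [h1, h2]
  have hspan : ⊤ ≤ (Submodule.span ℂ (Set.range o)).topologicalClosure := by
    set V := (Submodule.span ℂ (Set.range o)).topologicalClosure with hV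
    have hVc : IsClosed (V : Set E) := Submodule.isClosed_topologicalClosure _
    have hrk : ∀ η ζ : H2, j (K.tm (rk lam 1 η) (rk lam 1 ζ)) ∈ V := by
      have hone : ∀ (η : H2) (h : G2), j (K.tm (rk lam 1 η) (rk lam 1 (xi h))) ∈ V := by
        intro η h
        let F : H2 →ₗ[ℂ] E := j ∘ₗ LinearMap.mulRight ℂ (K.ι₂ (rk lam 1 (xi h))) ∘ₗ
          (K.ι₁ : ASalg lam →ₗ[ℂ] T) ∘ₗ (rkL lam 1 : H2 →ₗ[ℂ] ASalg lam)
        have hF : Continuous fun η => j (K.ι₁ (rkL lam 1 η) * K.ι₂ (rk lam 1 (xi h))) :=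
          hjc.comp ((K.isometry₁.continuous.comp (rkL lam 1).continuous).mul continuous_const)
        exact mem_of_forall_xi_mem (S := V.comap F) (hVc.preimage hF)
          (fun g => Submodule.le_topologicalClosure _ (Submodule.subset_span ⟨(g, h), rfl⟩)) η
      intro η ζ
      let F : H2 →ₗ[ℂ] E := j ∘ₗ LinearMap.mulLeft ℂ (K.ι₁ (rk lam 1 η)) ∘ₗ
        (K.ι₂ : ASalg lam →ₗ[ℂ] T) ∘ₗ (rkL lam 1 : H2 →ₗ[ℂ] ASalg lam)
      have hF : Continuous fun ζ => j (K.ι₁ (rk lam 1 η) * K.ι₂ (rkL lam 1 ζ)) :=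
        hjc.comp (continuous_const.mul (K.isometry₂.continuous.comp (rkL lam 1).continuous))
      exact mem_of_forall_xi_mem (S := V.comap F) (hVc.preimage hF) (fun g => hone η g) ζ
    have hjV : ∀ y, j y ∈ V := by
      intro y
      refine K.induction (S := V.comap j) (hVc.preimage hjc) (fun a b => ?_) y
      have h1 : j (K.tm a b - K.tm a b * minProj K) = 0 := by
        rw [← hj0, sub_mul, mul_assoc, minProj_mul_self, sub_self]
      rw [map_sub, sub_eq_zero, tm_mul_minProj] at h1
      change j (K.tm a b) ∈ V
      rw [h1]
      exact hrk _ _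
    intro v _
    exact hVc.closure_subset_iff.mpr (by rintro _ ⟨y, rfl⟩; exact hjV y) (hjd v)
  let b : HilbertBasis (G2 × G2) ℂ E := HilbertBasis.mk ho hspan
  have hb : ∀ x, b x = o x := fun x => by
    rw [show (b : G2 × G2 → E) = o from HilbertBasis.coe_mk ho hspan]
  have hid : ∀ v, Ψ (diagLam K 1) v = v := by
    intro v
    refine congrFun (hjd.equalizer (Ψ (diagLam K 1)).continuous continuous_id (funext fun y => ?_)) v
    change Ψ (diagLam K 1) (j y) = j y
    rw [hΨ, diagLam, lamA_one hlam, tm_oneA_mul]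
  have hnorm : ∀ g v, ‖Ψ (diagLam K g) v‖ = ‖v‖ := by
    intro g v
    have h1 : Ψ (star (diagLam K g)) (Ψ (diagLam K g) v) = v := by
      refine congrFun (hjd.equalizer ((Ψ (star (diagLam K g))).continuous.comp
        (Ψ (diagLam K g)).continuous) continuous_id (funext fun y => ?_)) v
      change Ψ (star (diagLam K g)) (Ψ (diagLam K g) (j y)) = j y
      rw [hΨ, hΨ, star_diagLam_mul K hlam]
    have h2 : ‖Ψ (diagLam K g) v‖ ^ 2 = ‖v‖ ^ 2 := by
      have h3 : inner ℂ (Ψ (diagLam K g) v) (Ψ (diagLam K g) v) = inner ℂ v v := by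
        rw [← ContinuousLinearMap.adjoint_inner_right, ← ContinuousLinearMap.star_eq_adjoint,
          ← map_star, h1]
      rw [inner_self_eq_norm_sq_to_K, inner_self_eq_norm_sq_to_K] at h3
      exact Complex.ofReal_injective (by push_cast; exact h3)
    rwa [sq_eq_sq₀ (norm_nonneg _) (norm_nonneg _)] at h2
  have hbasis : ∀ k g h, Ψ (diagLam K k) (b (g, h)) = b (k * g, k * h) := by
    intro k g h
    rw [hb, hb, hΨ, diagLam, K.tm_mul_tm, lamA_mul_rk hlam, lamA_mul_rk hlam]
  have hle : ‖Ψ (diagLam K 1) + Ψ (diagLam K (FreeGroup.of 0)) + Ψ (diagLam K (FreeGroup.of 1))‖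
      ≤ Real.sqrt (9 - 1 / 8) := by
    refine ContinuousLinearMap.opNorm_le_bound _ (Real.sqrt_nonneg _) fun v => ?_
    have h1 := norm_sq_add_freeGroup_le b _ _ (hnorm (FreeGroup.of 0)) (hnorm (FreeGroup.of 1))
      (hbasis _) (hbasis _) v
    rw [← Real.sqrt_sq (norm_nonneg v), ← Real.sqrt_mul (by norm_num)]
    apply Real.le_sqrt_of_sq_le
    simpa only [add_apply, hid] using h1
  exact hle.trans_lt (by rw [Real.sqrt_lt' (by norm_num)]; norm_num)

end Kernel

/-! ### Elements acting asymptotically as scalars -/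

/-- The elements which act as one and the same scalar on `x` and on all but finitely many of
the `E g`. -/
def asympScalar {T : Type*} [NonUnitalCStarAlgebra T] {x : T} (hx : star x = x) {E : G2 → T}
    (hE : ∀ g, star (E g) = E g) : NonUnitalStarSubalgebra ℂ T where
  carrier := {m | ∃ s : ℂ, (m * x = s • x ∧ x * m = s • x) ∧
    ∀ᶠ g in Filter.cofinite, m * E g = s • E g ∧ E g * m = s • E g}
  add_mem' := by
    rintro m m' ⟨s, ⟨h1, h2⟩, h3⟩ ⟨s', ⟨h1', h2'⟩, h3'⟩
    refine ⟨s + s', ⟨by rw [add_mul, h1, h1', add_smul], by rw [mul_add, h2, h2', add_smul]⟩, ?_⟩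
    filter_upwards [h3, h3'] with g h h'
    exact ⟨by rw [add_mul, h.1, h'.1, add_smul], by rw [mul_add, h.2, h'.2, add_smul]⟩
  zero_mem' := ⟨0, ⟨by simp, by simp⟩, Filter.Eventually.of_forall fun g => ⟨by simp, by simp⟩⟩
  mul_mem' := by
    rintro m m' ⟨s, ⟨h1, h2⟩, h3⟩ ⟨s', ⟨h1', h2'⟩, h3'⟩
    have left : ∀ y, m * y = s • y → m' * y = s' • y → m * m' * y = (s * s') • y :=
      fun y h h' => by rw [mul_assoc, h', mul_smul_comm, h, smul_smul, mul_comm]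
    have right : ∀ y, y * m = s • y → y * m' = s' • y → y * (m * m') = (s * s') • y :=
      fun y h h' => by rw [← mul_assoc, h, smul_mul_assoc, h', smul_smul]
    refine ⟨s * s', ⟨left x h1 h1', right x h2 h2'⟩, ?_⟩
    filter_upwards [h3, h3'] with g h h'
    exact ⟨left _ h.1 h'.1, right _ h.2 h'.2⟩
  smul_mem' := by
    rintro c m ⟨s, ⟨h1, h2⟩, h3⟩
    refine ⟨c * s, ⟨by rw [smul_mul_assoc, h1, smul_smul],
      by rw [mul_smul_comm, h2, smul_smul]⟩, ?_⟩
    filter_upwards [h3] with g h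
    exact ⟨by rw [smul_mul_assoc, h.1, smul_smul], by rw [mul_smul_comm, h.2, smul_smul]⟩
  star_mem' := by
    rintro m ⟨s, ⟨h1, h2⟩, h3⟩
    have left : ∀ y, star y = y → y * m = s • y → star m * y = star s • y := fun y hy h => by
      have := congrArg star h
      rwa [star_mul, star_smul, hy] at this
    have right : ∀ y, star y = y → m * y = s • y → y * star m = star s • y := fun y hy h => by
      have := congrArg star h
      rwa [star_mul, star_smul, hy] at this
    refine ⟨star s, ⟨left x hx h2, right x hx h1⟩, ?_⟩
    filter_upwards [h3] with g h
    exact ⟨left _ (hE g) h.2, right _ (hE g) h.1⟩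

theorem commute_of_mem_closure_asympScalar {T : Type*} [NonUnitalCStarAlgebra T] {x : T}
    (hx : star x = x) {E : G2 → T} (hE : ∀ g, star (E g) = E g) {m : T}
    (hm : m ∈ closure (asympScalar hx hE : Set T)) : m * x = x * m := by
  have hc : IsClosed {m : T | m * x = x * m} := isClosed_eq (by fun_prop) (by fun_prop)
  refine closure_minimal ?_ hc hm
  rintro m ⟨s, ⟨h1, h2⟩, -⟩
  exact h1.trans h2.symm

theorem notMem_closure_asympScalar {T : Type*} [NonUnitalCStarAlgebra T] {x : T}
    (hx : star x = x) {E : G2 → T} (hE : ∀ g, star (E g) = E g) (hx0 : x ≠ 0)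
    (hE0 : ∀ g, E g ≠ 0) (hxE : ∀ g, x * E g = 0) :
    x ∉ closure (asympScalar hx hE : Set T) := by
  intro hmem
  have hsq : x * x ≠ 0 := by
    have := (CStarRing.star_mul_self_eq_zero_iff (x := x)).not.mpr hx0
    rwa [hx] at this
  have hclosed : IsClosed {m : T | ‖m * x‖ ≤ ‖m - x‖ * ‖x‖} :=
    isClosed_le (by fun_prop) (by fun_prop)
  have := closure_minimal (t := {m : T | ‖m * x‖ ≤ ‖m - x‖ * ‖x‖}) ?_ hclosed hmem
  · have h1 : ‖x * x‖ ≤ ‖x - x‖ * ‖x‖ := this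
    rw [sub_self, norm_zero, zero_mul] at h1
    exact hsq (norm_le_zero_iff.mp h1)
  rintro m ⟨s, ⟨h1, -⟩, h3⟩
  obtain ⟨g, hg, -⟩ := h3.exists
  have hs : ‖s‖ ≤ ‖m - x‖ := by
    have h4 : (m - x) * E g = s • E g := by rw [sub_mul, hxE, sub_zero, hg]
    have h5 : ‖s‖ * ‖E g‖ ≤ ‖m - x‖ * ‖E g‖ := by
      rw [← norm_smul, ← h4]
      exact norm_mul_le _ _
    exact le_of_mul_le_mul_right h5 (norm_pos_iff.mpr (hE0 g))
  change ‖m * x‖ ≤ _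
  rw [h1, norm_smul]
  exact mul_le_mul_of_nonneg_right hs (norm_nonneg _)

section Diagonal

variable {T : Type*} [NonUnitalCStarAlgebra T] (K : CStarCompletion (ASalg lam) (ASalg lam) T)

theorem exists_ι_mem_asympScalar {x : T} (hx : star x = x) {E : G2 → T}
    (hE : ∀ g, star (E g) = E g) (h1 : ∀ g, x * K.ι₁ (rk lam g (xi g)) = 0)
    (h2 : ∀ g g', g ≠ g' → K.ι₁ (rk lam g (xi g)) * E g' = 0) {c : H2 →L[ℂ] H2}
    (hc : c ∈ StarAlgebra.adjoin ℂ (Set.range fun g : G2 => EE g g)) :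
    ∃ h : c ∈ ASalg lam, K.ι₁ ⟨c, h⟩ ∈ asympScalar hx hE := by
  have hright : ∀ y : T, star y = y → y * K.ι₁ (oneA lam) = y := by
    intro y hy
    have h3 : star (K.ι₁ (oneA lam)) = K.ι₁ (oneA lam) := by
      rw [← map_star]
      exact congrArg K.ι₁ (Subtype.ext (star_one _))
    have := congrArg star (K.ι_one_mul oneA_mul y)
    rwa [star_mul, hy, h3] at this
  induction hc using StarAlgebra.adjoin_induction with
  | mem c hc =>
    obtain ⟨g, rfl⟩ := hc
    have hs : star (K.ι₁ (rk lam g (xi g))) = K.ι₁ (rk lam g (xi g)) := by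
      rw [← map_star, star_rk]
    have hswap : ∀ y : T, star y = y → y * K.ι₁ (rk lam g (xi g)) = 0 →
        K.ι₁ (rk lam g (xi g)) * y = 0 := by
      intro y hy h
      have := congrArg star h
      rwa [star_mul, hy, hs, star_zero] at this
    have hswap' : ∀ y : T, star y = y → K.ι₁ (rk lam g (xi g)) * y = 0 →
        y * K.ι₁ (rk lam g (xi g)) = 0 := by
      intro y hy h
      have := congrArg star h
      rwa [star_mul, hy, hs, star_zero] at this
    refine ⟨(rk lam g (xi g)).2, 0, ⟨?_, ?_⟩, ?_⟩
    · rw [zero_smul]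
      exact hswap x hx (h1 g)
    · rw [zero_smul]
      exact h1 g
    · filter_upwards [(Set.finite_singleton g).compl_mem_cofinite] with g' hg'
      have h3 := h2 g g' fun h => hg' h.symm
      rw [zero_smul]
      exact ⟨h3, hswap' _ (hE g') h3⟩
  | algebraMap r =>
    have h : algebraMap ℂ (H2 →L[ℂ] H2) r ∈ ASalg lam := by
      rw [Algebra.algebraMap_eq_smul_one]
      exact (r • oneA lam).2
    have h3 : K.ι₁ ⟨_, h⟩ = r • K.ι₁ (oneA lam) := by
      rw [← map_smul]
      exact congrArg K.ι₁ (Subtype.ext (Algebra.algebraMap_eq_smul_one r))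
    have h4 : ∀ y : T, star y = y → K.ι₁ ⟨_, h⟩ * y = r • y ∧ y * K.ι₁ ⟨_, h⟩ = r • y := by
      intro y hy
      rw [h3, smul_mul_assoc, mul_smul_comm, hright y hy, K.ι_one_mul oneA_mul]
      exact ⟨rfl, rfl⟩
    exact ⟨h, r, h4 x hx, Filter.Eventually.of_forall fun g => h4 _ (hE g)⟩
  | add c d _ _ hc hd =>
    obtain ⟨hc, hc'⟩ := hc
    obtain ⟨hd, hd'⟩ := hd
    refine ⟨add_mem hc hd, ?_⟩
    have := add_mem hc' hd'
    rwa [← map_add] at this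
  | mul c d _ _ hc hd =>
    obtain ⟨hc, hc'⟩ := hc
    obtain ⟨hd, hd'⟩ := hd
    refine ⟨mul_mem hc hd, ?_⟩
    have := mul_mem hc' hd'
    rwa [← map_mul] at this
  | star c _ hc =>
    obtain ⟨hc, hc'⟩ := hc
    refine ⟨star_mem hc, ?_⟩
    have := star_mem hc'
    rwa [← map_star] at this

theorem ι_mem_closure_asympScalar {x : T} (hx : star x = x) {E : G2 → T}
    (hE : ∀ g, star (E g) = E g) (h1 : ∀ g, x * K.ι₁ (rk lam g (xi g)) = 0)
    (h2 : ∀ g g', g ≠ g' → K.ι₁ (rk lam g (xi g)) * E g' = 0) {c : ASalg lam}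
    (hc : (c : H2 →L[ℂ] H2) ∈ CS) : K.ι₁ c ∈ closure (asympScalar hx hE : Set T) := by
  set D := StarAlgebra.adjoin ℂ (Set.range fun g : G2 => EE g g) with hD
  have h3 : c ∈ closure {c : ASalg lam | (c : H2 →L[ℂ] H2) ∈ D} := by
    rw [closure_subtype]
    refine closure_mono ?_ hc
    intro d hd
    obtain ⟨h, -⟩ := exists_ι_mem_asympScalar K hx hE h1 h2 hd
    exact ⟨⟨d, h⟩, hd, rfl⟩
  refine map_mem_closure K.isometry₁.continuous h3 ?_
  intro d hd
  exact (exists_ι_mem_asympScalar K hx hE h1 h2 hd).2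

theorem tensorSet_subset_closure_asympScalar {x : T} (hx : star x = x) {E : G2 → T}
    (hE : ∀ g, star (E g) = E g) (h1 : ∀ g, x * K.ι₁ (rk lam g (xi g)) = 0)
    (h1' : ∀ g, x * K.ι₂ (rk lam g (xi g)) = 0)
    (h2 : ∀ g g', g ≠ g' → K.ι₁ (rk lam g (xi g)) * E g' = 0)
    (h2' : ∀ g g', g ≠ g' → K.ι₂ (rk lam g (xi g)) * E g' = 0) :
    tensorSet K {a : ASalg lam | (a : H2 →L[ℂ] H2) ∈ CS}
        {a : ASalg lam | (a : H2 →L[ℂ] H2) ∈ CS} ⊆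
      closure (asympScalar hx hE : Set T) := by
  refine closure_minimal ?_ isClosed_closure
  change _ ⊆ (((asympScalar hx hE).toSubmodule.topologicalClosure : Submodule ℂ T) : Set T)
  rw [SetLike.coe_subset_coe, Submodule.span_le]
  rintro _ ⟨a, ha, b, hb, rfl⟩
  exact map_mem_closure₂ continuous_mul (ι_mem_closure_asympScalar K hx hE h1 h2 ha)
    (ι_mem_closure_asympScalar K.flip hx hE h1' h2' hb) fun m hm n hn =>
      (asympScalar hx hE).mul_mem hm hn

theorem exists_mem_kernel (rho : G2 → (H2 →L[ℂ] H2))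
    (hlam : ∀ g h : G2, lam g (xi h) = xi (g * h))
    (hrho : ∀ g h : G2, rho g (xi h) = xi (h * g⁻¹))
    (q : ASalg lam → CrS lam)
    (hq : ∀ (x : ASalg lam) (a k : H2 →L[ℂ] H2), a ∈ CrS lam → IsCompactOperator k →
      (x : H2 →L[ℂ] H2) = a + k → (q x : H2 →L[ℂ] H2) = a)
    (ρh : CrS lam →⋆ₙₐ[ℂ] (H2 →L[ℂ] H2))
    (hρ : ∀ (g : G2) (hg : lam g ∈ CrS lam), ρh ⟨lam g, hg⟩ = rho g)
    (hdom : ∀ (n : ℕ) (a b : Fin n → ASalg lam),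
      ‖∑ i, ((q (a i) : H2 →L[ℂ] H2) * ρh (q (b i)))‖ ≤ ‖∑ i, K.ι₁ (a i) * K.ι₂ (b i)‖) :
    ∃ x : T, (∀ y, x * y * minProj K = 0) ∧ x ≠ 0 := by
  by_contra! hK
  have hlt := norm_diagLam_sum_lt K hlam hK
  have hqlam : ∀ g, q (lamA lam g) = ⟨lam g, lam_mem_CrS g⟩ := fun g =>
    Subtype.ext (hq _ _ 0 (lam_mem_CrS g) isCompactOperator_zero (add_zero _).symm)
  let S : Fin 3 → G2 := ![1, FreeGroup.of 0, FreeGroup.of 1]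
  have hle := hdom 3 (fun i => lamA lam (S i)) (fun i => lamA lam (S i))
  have hsum : ∑ i, K.ι₁ (lamA lam (S i)) * K.ι₂ (lamA lam (S i)) =
      diagLam K 1 + diagLam K (FreeGroup.of 0) + diagLam K (FreeGroup.of 1) :=
    Fin.sum_univ_three _
  rw [hsum] at hle
  have hone : ∀ g, (lam g * rho g) (xi 1) = xi 1 := by
    intro g
    change lam g (rho g (xi 1)) = xi 1
    rw [hrho, hlam, one_mul, mul_inv_cancel]
  have hxi : ‖xi 1‖ = 1 := orthonormal_xi.1 1
  have h3 : (3 : ℝ) ≤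
      ‖∑ i, ((q (lamA lam (S i)) : H2 →L[ℂ] H2) * ρh (q (lamA lam (S i))))‖ := by
    have hval : (∑ i, ((q (lamA lam (S i)) : H2 →L[ℂ] H2) * ρh (q (lamA lam (S i))))) (xi 1) =
        (3 : ℂ) • xi 1 := by
      simp only [hqlam, hρ, Fin.sum_univ_three, add_apply, hone]
      module
    have := ContinuousLinearMap.le_opNorm
      (∑ i, ((q (lamA lam (S i)) : H2 →L[ℂ] H2) * ρh (q (lamA lam (S i))))) (xi 1)
    rw [hval, norm_smul, hxi, mul_one, mul_one] at this
    simpa using this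
  exact absurd (h3.trans hle) (not_le.mpr hlt)

end Diagonal

end MinimalProjection

/-- Proposition 4, second part: for any C*-norm `β` on `A ⊙ A` dominating
`α = max(‖·‖_min, ‖π_r(·)‖)` (a C*-norm automatically dominates the minimal norm, so
domination of `α` is encoded by domination of the norm of the representation
`π_r(Σ aᵢ ⊗ bᵢ) = Σ λ(q(aᵢ)) ρ(q(bᵢ))`), the masa `C ⊗ C` is not maximal abelian in
`A ⊗_β A`; in particular it is not maximal abelian in `A ⊗_max A`. -/
theorem stmt_10 (lam rho : G2 → (H2 →L[ℂ] H2))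
    (hlam : ∀ g h : G2, lam g (xi h) = xi (g * h))
    (hrho : ∀ g h : G2, rho g (xi h) = xi (h * g⁻¹))
    {T : Type*} [NonUnitalCStarAlgebra T]
    (K : CStarCompletion ↥(ASalg lam) ↥(ASalg lam) T)
    (q : ↥(ASalg lam) → ↥(CrS lam))
    (hq : ∀ (x : ↥(ASalg lam)) (a k : H2 →L[ℂ] H2), a ∈ CrS lam → IsCompactOperator k →
      (x : H2 →L[ℂ] H2) = a + k → (q x : H2 →L[ℂ] H2) = a)
    (ρh : ↥(CrS lam) →⋆ₙₐ[ℂ] (H2 →L[ℂ] H2))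
    (hρ : ∀ (g : G2) (hg : lam g ∈ CrS lam), ρh ⟨lam g, hg⟩ = rho g)
    (hdom : ∀ (n : ℕ) (a b : Fin n → ↥(ASalg lam)),
      ‖∑ i, ((q (a i) : H2 →L[ℂ] H2) * ρh (q (b i)))‖ ≤
        ‖∑ i, K.ι₁ (a i) * K.ι₂ (b i)‖) :
    ∃ x : T,
      x ∉ tensorSet K {a : ↥(ASalg lam) | (a : H2 →L[ℂ] H2) ∈ CS}
            {a : ↥(ASalg lam) | (a : H2 →L[ℂ] H2) ∈ CS} ∧
      ∀ m ∈ tensorSet K {a : ↥(ASalg lam) | (a : H2 →L[ℂ] H2) ∈ CS}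
            {a : ↥(ASalg lam) | (a : H2 →L[ℂ] H2) ∈ CS}, m * x = x * m := by
  obtain ⟨x₀, hx₀, hne⟩ := exists_mem_kernel K rho hlam hrho q hq ρh hρ hdom
  have hx : star (star x₀ * x₀) = star x₀ * x₀ := by rw [star_mul, star_star]
  have hxk : ∀ y, star x₀ * x₀ * y * minProj K = 0 := fun y => by
    have := hx₀ y
    rw [mul_assoc] at this
    rw [mul_assoc, mul_assoc, this, mul_zero]
  have hx0 : star x₀ * x₀ ≠ 0 := (CStarRing.star_mul_self_eq_zero_iff (x := x₀)).not.mpr hne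
  let E : G2 → T := fun g => K.tm (rk lam g (xi g)) (rk lam g (xi g))
  have hE : ∀ g, star (E g) = E g := fun g => by
    change star (K.tm _ _) = K.tm _ _
    rw [K.star_tm, star_rk]
  have hE0 : ∀ g, E g ≠ 0 := fun g h =>
    rk_xi_ne_zero g g (K.eq_zero_of_tm_eq_zero (rk_xi_ne_zero g g) h)
  have h1 := mul_ι_rk_eq_zero K hxk
  have h1' := mul_ι_rk_eq_zero' K hxk
  have hxE : ∀ g, star x₀ * x₀ * E g = 0 := fun g => by
    change _ * (K.ι₁ _ * K.ι₂ _) = 0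
    rw [← mul_assoc, h1, zero_mul]
  have horth : ∀ g g', g ≠ g' → rk lam g (xi g) * rk lam g' (xi g') = 0 := fun g g' h => by
    rw [rk_mul_rk, if_neg h, zero_smul]
  have h2 : ∀ g g', g ≠ g' → K.ι₁ (rk lam g (xi g)) * E g' = 0 := fun g g' h => by
    change _ * (K.ι₁ _ * K.ι₂ _) = 0
    rw [← mul_assoc, ← map_mul, horth g g' h, map_zero, zero_mul]
  have h2' : ∀ g g', g ≠ g' → K.ι₂ (rk lam g (xi g)) * E g' = 0 := fun g g' h => by
    change _ * (K.ι₁ _ * K.ι₂ _) = 0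
    rw [K.commutes, ← mul_assoc, ← map_mul, horth g g' h, map_zero, zero_mul]
  have hsub := tensorSet_subset_closure_asympScalar K hx hE h1 h1' h2 h2'
  exact ⟨star x₀ * x₀, fun h => notMem_closure_asympScalar hx hE hx0 hE0 hxE (hsub h),
    fun m hm => commute_of_mem_closure_asympScalar hx hE (hsub hm)⟩
end
end

section
/- Let D be a unital C*-algebra, C ⊆ D a unital abelian C*-subalgebra, and I a proper closed left ideal of D satisfying I·C ⊆ I (equivalently C ⊆ {d : Id ⊆ I}). Set J = {c ∈ C : c ∈ I}. Then J is a proper closed two-sided ideal of C, and for any character χ of C annihilating J there exists a state ψ on D with ψ|_I = 0 and ψ(c) = χ(c) for all c ∈ C. -/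
set_option maxHeartbeats 1000000
set_option synthInstance.maxHeartbeats 1000000

open scoped ComplexOrder TensorProduct

noncomputable section

/-- The trace of a left ideal `I` of `D` on a subalgebra `C`, `J = {c ∈ C : c ∈ I}`. -/
def idealRestrict {D : Type*} [CStarAlgebra D] (C : StarSubalgebra ℂ D) (I : Ideal D) :
    Ideal ↥C where
  carrier := {c : ↥C | (c : D) ∈ I}
  add_mem' := fun {a b} ha hb => by
    show ((a + b : ↥C) : D) ∈ I
    rw [AddMemClass.coe_add]
    exact I.add_mem ha hb
  zero_mem' := by
    show ((0 : ↥C) : D) ∈ I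
    rw [ZeroMemClass.coe_zero]
    exact I.zero_mem
  smul_mem' := fun c {x} hx => I.smul_mem (c : D) hx

/-- A bounded functional on a C⋆-algebra with norm at most one taking the value one at the
identity is a state. -/
theorem IsState.of_norm_le_one {D : Type*} [CStarAlgebra D] [Nontrivial D] {ψ : D →L[ℂ] ℂ}
    (hψ : ‖ψ‖ ≤ 1) (h1 : ψ 1 = 1) : IsState ψ := by
  let := CStarAlgebra.spectralOrder D
  have := CStarAlgebra.spectralOrderedRing D
  have hle : ∀ x, ‖ψ x‖ ≤ ‖x‖ := fun x => by
    simpa using ψ.le_of_opNorm_le hψ x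
  refine ⟨le_antisymm hψ ?_, fun a => ?_⟩
  · simpa [h1] using ψ.le_opNorm 1
  set h := star a * a with hh
  have h0 : 0 ≤ h := star_mul_self_nonneg a
  have hsa : IsSelfAdjoint h := .of_nonneg h0
  rw [Complex.nonneg_iff]
  constructor
  · have hb : ‖algebraMap ℝ D ‖h‖ - h‖ ≤ ‖h‖ :=
      (CStarAlgebra.norm_le_iff_le_algebraMap _ (norm_nonneg h)
        (sub_nonneg.2 hsa.le_algebraMap_norm_self)).2 (sub_le_self _ h0)
    have h2 := (hle _).trans hb
    have h3 : ψ (algebraMap ℝ D ‖h‖ - h) = (‖h‖ : ℂ) - ψ h := by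
      rw [map_sub, IsScalarTower.algebraMap_apply ℝ ℂ D, Algebra.algebraMap_eq_smul_one, map_smul,
        h1]
      simp
    rw [h3] at h2
    have h4 := (Complex.re_le_norm _).trans h2
    simp only [Complex.sub_re, Complex.ofReal_re] at h4
    linarith
  · have key : ∀ t : ℝ, ((ψ h).im + t) ^ 2 ≤ ‖h‖ ^ 2 + t ^ 2 := fun t => by
      have h2 : ψ (h + (t * Complex.I : ℂ) • 1) = ψ h + t * Complex.I := by simp [h1]
      have h3 : ‖h + (t * Complex.I : ℂ) • (1 : D)‖ ^ 2 ≤ ‖h‖ ^ 2 + t ^ 2 := by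
        rw [sq, ← CStarRing.norm_star_mul_self]
        have : star (h + (t * Complex.I : ℂ) • (1 : D)) * (h + (t * Complex.I : ℂ) • (1 : D))
            = h * h + ((t ^ 2 : ℝ) : ℂ) • 1 := by
          have hI : (t * Complex.I : ℂ) * (t * Complex.I) = -((t ^ 2 : ℝ) : ℂ) := by
            push_cast; linear_combination (t : ℂ) ^ 2 * Complex.I_sq
          simp only [star_add, hsa.star_eq, star_smul, star_one, add_mul, mul_add, smul_mul_assoc,
            mul_smul_comm, one_mul, mul_one, smul_add, smul_neg, smul_smul, RCLike.star_def, map_mul,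
            Complex.conj_ofReal, Complex.conj_I, mul_neg, neg_mul, hI, neg_smul, neg_neg]
          abel
        rw [this]
        refine (norm_add_le _ _).trans (add_le_add ?_ ?_)
        · rw [sq]; exact norm_mul_le _ _
        · rw [norm_smul, norm_one, mul_one, Complex.norm_real, Real.norm_of_nonneg (sq_nonneg t)]
      have h4 : |(ψ h).im + t| ≤ ‖h + (t * Complex.I : ℂ) • (1 : D)‖ := by
        refine le_trans ?_ (hle _)
        rw [h2]
        simpa using Complex.abs_im_le_norm (ψ h + t * Complex.I)
      calc ((ψ h).im + t) ^ 2 = |(ψ h).im + t| ^ 2 := (sq_abs _).symm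
        _ ≤ _ := by gcongr
        _ ≤ _ := h3
    by_contra hne
    have hne' : (ψ h).im ≠ 0 := fun h => hne h.symm
    have := key (‖h‖ ^ 2 / (ψ h).im)
    have h5 : (ψ h).im * (‖h‖ ^ 2 / (ψ h).im) = ‖h‖ ^ 2 := by field_simp
    have h6 : 0 < (ψ h).im ^ 2 := by positivity
    nlinarith [sq_nonneg ‖h‖]

/-- Closed left ideals of a C⋆-algebra are hereditary: if `b⋆b ≤ y⋆y` and `y` lies in the
ideal, then so does `b`. -/
theorem mem_of_star_mul_self_le {D : Type*} [CStarAlgebra D] [PartialOrder D] [StarOrderedRing D]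
    {I : Ideal D} (hI : IsClosed (I : Set D)) {b y : D} (hy : y ∈ I)
    (hby : star b * b ≤ star y * y) : b ∈ I := by
  rcases subsingleton_or_nontrivial D with hD | hD
  · rw [Subsingleton.elim b y]; exact hy
  set h := star y * y with hh
  have h0 : 0 ≤ h := star_mul_self_nonneg y
  have hsa : IsSelfAdjoint h := .of_nonneg h0
  have hspec : ∀ t ∈ spectrum ℝ h, 0 ≤ t := fun t ht => spectrum_nonneg_of_nonneg h0 ht
  have approx : ∀ ε : ℝ, 0 < ε → ∃ x ∈ I, ‖b - x‖ ^ 2 ≤ ε := fun ε hε => by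
    have hne : ∀ t ∈ spectrum ℝ h, ε + t ≠ 0 := fun t ht => by have := hspec t ht; positivity
    have hcv : ContinuousOn (fun t : ℝ => (ε + t)⁻¹) (spectrum ℝ h) :=
      ContinuousOn.inv₀ (by fun_prop) hne
    have hcw : ContinuousOn (fun t : ℝ => ε * (ε + t)⁻¹) (spectrum ℝ h) :=
      continuousOn_const.mul hcv
    set v := cfc (fun t : ℝ => (ε + t)⁻¹) h with hv
    set w := cfc (fun t : ℝ => ε * (ε + t)⁻¹) h with hw
    have hid : cfc (fun t : ℝ => t) h = h := cfc_id' ℝ h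
    have hwv : w + v * h = 1 := by
      calc w + v * h = w + v * cfc (fun t : ℝ => t) h := by rw [hid]
        _ = cfc (fun t : ℝ => ε * (ε + t)⁻¹ + (ε + t)⁻¹ * t) h := by
          rw [hv, ← cfc_mul _ _ h hcv (by fun_prop), hw,
            ← cfc_add (a := h) (fun t => ε * (ε + t)⁻¹) (fun t => (ε + t)⁻¹ * t) hcw
              (hcv.mul continuousOn_id)]
        _ = cfc (fun _ : ℝ => 1) h := cfc_congr fun t ht => by
          have := hne t ht
          field_simp
        _ = 1 := cfc_const_one ℝ h
    have hwsa : star w = w := (cfc_predicate (p := IsSelfAdjoint) _ h : IsSelfAdjoint w)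
    have hwhw : w * h * w = cfc (fun t : ℝ => ε * (ε + t)⁻¹ * t * (ε * (ε + t)⁻¹)) h := by
      calc w * h * w = w * cfc (fun t : ℝ => t) h * w := by rw [hid]
        _ = _ := by
          rw [hw, ← cfc_mul _ _ h hcw (by fun_prop),
            ← cfc_mul (a := h) (fun t => ε * (ε + t)⁻¹ * t) _ (hcw.mul continuousOn_id) hcw]
    refine ⟨b * v * star y * y, I.mul_mem_left _ hy, ?_⟩
    have hbx : b - b * v * star y * y = b * w := by
      rw [eq_sub_of_add_eq hwv, hh]
      noncomm_ring
    rw [hbx, sq, ← CStarRing.norm_star_mul_self]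
    have hle : star (b * w) * (b * w) ≤ w * h * w := by
      have := star_left_conjugate_le_conjugate hby w
      rw [hwsa] at this
      simpa [hwsa, mul_assoc] using this
    refine (CStarAlgebra.norm_le_norm_of_nonneg_of_le (star_mul_self_nonneg _) hle).trans ?_
    rw [hwhw]
    refine norm_cfc_le hε.le fun t ht => ?_
    have ht0 := hspec t ht
    rw [Real.norm_of_nonneg (by positivity)]
    have : ε * (ε + t)⁻¹ * t * (ε * (ε + t)⁻¹) = ε * (ε * t) / (ε + t) ^ 2 := by
      field_simp
    rw [this, div_le_iff₀ (by positivity)]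
    nlinarith [mul_pos hε hε, mul_nonneg hε.le ht0, mul_nonneg hε.le (mul_nonneg ht0 ht0),
      mul_pos hε (mul_pos hε hε), mul_nonneg hε.le (mul_nonneg hε.le ht0)]
  have : b ∈ closure (I : Set D) := Metric.mem_closure_iff.2 fun ε hε => by
    obtain ⟨x, hx, hbx⟩ := approx ((ε / 2) ^ 2) (by positivity)
    refine ⟨x, hx, ?_⟩
    rw [dist_eq_norm]
    have := (abs_le.1 (abs_le_of_sq_le_sq hbx (by positivity))).2
    linarith
  rwa [hI.closure_eq] at this

/-- A character of a C⋆-subalgebra `C` which vanishes on `C ∩ I`, where `I` is a closed left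
ideal with `I * C ⊆ I`, is contractive for the quotient norm of `D ⧸ I`. -/
theorem norm_character_le_norm_add {D : Type*} [CStarAlgebra D] (C : StarSubalgebra ℂ D)
    (hC : IsClosed (C : Set D)) {I : Ideal D} (hI : IsClosed (I : Set D))
    (hIC : ∀ x ∈ I, ∀ c ∈ C, x * c ∈ I) (χ : WeakDual.characterSpace ℂ C)
    (hχ : ∀ c : C, (c : D) ∈ I → χ c = 0) (c : C) {y : D} (hy : y ∈ I) :
    ‖χ c‖ ≤ ‖(c : D) + y‖ := by
  let := CStarAlgebra.spectralOrder D
  have := CStarAlgebra.spectralOrderedRing D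
  let : CStarAlgebra C := StarSubalgebra.cstarAlgebra C (h_closed := hC)
  let := CStarAlgebra.spectralOrder C
  have := CStarAlgebra.spectralOrderedRing C
  have hχstar : ∀ p : C, χ (star p * p) = ((‖χ p‖ ^ 2 : ℝ) : ℂ) := fun p => by
    rw [map_mul, map_star, RCLike.star_def, Complex.conj_mul']
    push_cast; rfl
  set r := ‖(c : D) + y‖ with hr
  have main : ∀ s : ℝ, 0 < s → ‖χ c‖ ^ 2 ≤ (1 + s ^ 2) * r ^ 2 := fun s hs => by
    set m : ℝ := (1 + s ^ 2) * r ^ 2 with hm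
    set κ : ℝ := √(1 + s⁻¹ ^ 2) with hκ
    have hκ2 : κ * κ = 1 + s⁻¹ ^ 2 := Real.mul_self_sqrt (by positivity)
    set a : C := star c * c - (m : ℂ) • 1 with ha
    have hasa : IsSelfAdjoint a := by
      refine (IsSelfAdjoint.star_mul_self c).sub ?_
      exact IsSelfAdjoint.smul (by simp [IsSelfAdjoint]) (.one _)
    have hle : (a : D) ≤ star (κ • y) * (κ • y) := by
      have h1 : star ((c : D) + y) * (c + y) ≤ (r ^ 2) • (1 : D) := by
        rw [← Algebra.algebraMap_eq_smul_one]
        exact CStarAlgebra.star_mul_le_algebraMap_norm_sq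
      have h2 : (1 + s ^ 2) • (star ((c : D) + y) * (c + y)) ≤ (1 + s ^ 2) • (r ^ 2) • (1 : D) :=
        smul_le_smul_of_nonneg_left h1 (by positivity)
      have h3 := star_mul_self_nonneg (s • ((c : D) + y) + s⁻¹ • y)
      have h4 : star (κ • y) * (κ • y) - (a : D)
          = ((1 + s ^ 2) • (r ^ 2) • (1 : D) - (1 + s ^ 2) • (star ((c : D) + y) * (c + y)))
            + star (s • ((c : D) + y) + s⁻¹ • y) * (s • ((c : D) + y) + s⁻¹ • y) := by
        have hac : (a : D) = star (c : D) * c - m • 1 := by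
          rw [ha, ← Complex.coe_smul]; rfl
        have hss : s * s⁻¹ = 1 := mul_inv_cancel₀ hs.ne'
        have hss' : s⁻¹ * s = 1 := inv_mul_cancel₀ hs.ne'
        rw [hac, hm]
        simp only [star_add, star_smul, star_trivial, add_mul, mul_add, smul_mul_assoc,
          mul_smul_comm, smul_smul, smul_add, hκ2, hss, hss', one_smul, add_smul]
        simp only [sq, one_mul]
        abel
      rw [← sub_nonneg, h4]
      exact add_nonneg (sub_nonneg.2 h2) h3
    obtain ⟨q, hq⟩ := CStarAlgebra.nonneg_iff_eq_star_mul_self.1 (CFC.posPart_nonneg a)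
    obtain ⟨p, hp⟩ := CStarAlgebra.nonneg_iff_eq_star_mul_self.1 (CFC.negPart_nonneg a)
    have hsub : a⁺ - a⁻ = a := CFC.posPart_sub_negPart a hasa
    have hfsa : star a⁺ = a⁺ := (IsSelfAdjoint.of_nonneg (CFC.posPart_nonneg a))
    have hconj : star (q * a⁺) * (q * a⁺) = star a⁺ * a * a⁺ := by
      have h1 : star (q * a⁺) * (q * a⁺) = star a⁺ * (star q * q) * a⁺ := by
        simp only [star_mul, mul_assoc]
      have h2 : a * a⁺ = a⁺ * a⁺ := by
        calc a * a⁺ = (a⁺ - a⁻) * a⁺ := by rw [hsub]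
          _ = a⁺ * a⁺ := by rw [sub_mul, CFC.negPart_mul_posPart, sub_zero]
      rw [h1, ← hq, mul_assoc, mul_assoc, h2]
    have hmem : ((q * a⁺ : C) : D) ∈ I := by
      have hyI : κ • y ∈ I := by
        rw [← one_mul y, ← smul_mul_assoc]; exact I.mul_mem_left _ hy
      refine mem_of_star_mul_self_le hI (hIC _ hyI _ (a⁺ : C).2) ?_
      have h1 := star_left_conjugate_le_conjugate hle ((a⁺ : C) : D)
      have h2 : star ((q * a⁺ : C) : D) * ((q * a⁺ : C) : D)
          = star ((a⁺ : C) : D) * a * ((a⁺ : C) : D) := congrArg Subtype.val hconj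
      rw [h2]
      simpa only [star_mul, mul_assoc] using h1
    have hχf : χ a⁺ = 0 := by
      have h1 := hχ _ hmem
      rw [map_mul] at h1
      rcases mul_eq_zero.1 h1 with h | h
      · rw [hq, map_mul, h, mul_zero]
      · exact h
    have hχa : χ a = -((‖χ p‖ ^ 2 : ℝ) : ℂ) := by
      rw [← hχstar, ← hp]
      conv_lhs => rw [← hsub]
      rw [map_sub, hχf, zero_sub]
    have hχa' : χ a = ((‖χ c‖ ^ 2 - m : ℝ) : ℂ) := by
      rw [ha, map_sub, hχstar, map_smul, map_one]
      push_cast; simp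
    rw [hχa'] at hχa
    have : ‖χ c‖ ^ 2 - m = -‖χ p‖ ^ 2 := by exact_mod_cast hχa
    nlinarith [sq_nonneg ‖χ p‖]
  refine abs_le_of_sq_le_sq' ?_ (norm_nonneg _) |>.2
  have hlim : Filter.Tendsto (fun s : ℝ => (1 + s ^ 2) * r ^ 2) (nhdsWithin 0 (Set.Ioi 0))
      (nhds ((1 + 0 ^ 2) * r ^ 2)) :=
    (Continuous.tendsto (by fun_prop) _).mono_left nhdsWithin_le_nhds
  have := ge_of_tendsto hlim (Filter.eventually_of_mem self_mem_nhdsWithin fun s hs => main s hs)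
  simpa using this

/-- if `I` is a proper closed left ideal of `D` with `I·C ⊆ I` for a unital
abelian C*-subalgebra `C`, then `J = C ∩ I` is a proper closed ideal of `C`, and any
character of `C` annihilating `J` extends to a state of `D` vanishing on `I`. -/
theorem stmt_13 {D : Type*} [CStarAlgebra D]
    (C : StarSubalgebra ℂ D) (hCab : ∀ x ∈ C, ∀ y ∈ C, x * y = y * x)
    (hCcl : IsClosed (C : Set D))
    (I : Ideal D) (hIprop : I ≠ ⊤) (hIcl : IsClosed (I : Set D))
    (habs : ∀ x ∈ I, ∀ c ∈ C, x * c ∈ I) :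
    idealRestrict C I ≠ ⊤ ∧ IsClosed ((idealRestrict C I : Set ↥C)) ∧
    ∀ χ : WeakDual.characterSpace ℂ ↥C,
      (∀ c ∈ idealRestrict C I, (χ : WeakDual ℂ ↥C) c = 0) →
      ∃ ψ : D →L[ℂ] ℂ, IsState ψ ∧ (∀ y ∈ I, ψ y = 0) ∧
        ∀ c : ↥C, ψ ↑c = (χ : WeakDual ℂ ↥C) c := by
  refine ⟨fun h => hIprop ?_, hIcl.preimage continuous_subtype_val, fun χ hχ => ?_⟩
  · rw [Ideal.eq_top_iff_one] at h ⊢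
    exact h
  have : Nontrivial D := by
    by_contra hD
    rw [not_nontrivial_iff_subsingleton] at hD
    exact hIprop (Subsingleton.elim _ _)
  let f : D →ₗ.[ℂ] ℂ :=
    ⟨Subalgebra.toSubmodule C.toSubalgebra,
      { toFun := fun c => χ (⟨c, c.2⟩ : C)
        map_add' := fun x y => map_add χ (⟨x, x.2⟩ : C) ⟨y, y.2⟩
        map_smul' := fun k x => map_smul χ k (⟨x, x.2⟩ : C) }⟩
  let g : D →ₗ.[ℂ] ℂ := ⟨I.restrictScalars ℂ, 0⟩
  have H : ∀ (x : f.domain) (y : g.domain), (x : D) = y → f x = g y := fun x y hxy =>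
    hχ ⟨x, x.2⟩ (show (x : D) ∈ I from hxy ▸ y.2)
  have hbound : ∀ z, ‖(f.sup g H).toFun z‖ ≤ 1 * ‖z‖ := by
    rintro ⟨z, hz⟩
    obtain ⟨x, hx, y, hy, rfl⟩ := Submodule.mem_sup.1 hz
    have h1 : (f.sup g H).toFun ⟨x + y, hz⟩ = f ⟨x, hx⟩ + g ⟨y, hy⟩ :=
      LinearPMap.sup_apply H ⟨x, hx⟩ ⟨y, hy⟩ ⟨x + y, hz⟩ rfl
    have h2 : g ⟨y, hy⟩ = 0 := rfl
    rw [h1, h2, add_zero, one_mul]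
    exact norm_character_le_norm_add C hCcl hIcl habs χ (fun c hc => hχ c hc) ⟨x, hx⟩ hy
  obtain ⟨ψ, hψ, hψn⟩ := exists_extension_norm_eq _ ((f.sup g H).toFun.mkContinuous 1 hbound)
  have hψC : ∀ c : C, ψ c = χ c := fun c => by
    refine (hψ ⟨c, Submodule.mem_sup_left c.2⟩).trans ?_
    refine (LinearPMap.sup_apply H ⟨c, c.2⟩ 0 ⟨c, Submodule.mem_sup_left c.2⟩ (add_zero _)).trans ?_
    exact add_zero (χ c)
  have hψI : ∀ y ∈ I, ψ y = 0 := fun y hy => by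
    refine (hψ ⟨y, Submodule.mem_sup_right hy⟩).trans ?_
    refine (LinearPMap.sup_apply H 0 ⟨y, hy⟩ ⟨y, Submodule.mem_sup_right hy⟩ (zero_add _)).trans ?_
    exact (add_zero _).trans (map_zero χ)
  refine ⟨ψ, .of_norm_le_one ?_ ?_, hψI, hψC⟩
  · rw [hψn]
    exact LinearMap.mkContinuous_norm_le _ zero_le_one _
  · exact (hψC 1).trans (map_one χ)
end
end

section
/- Let C be a masa of a unital C*-algebra A. Then C has the extension property if and only if for every x ∈ A, the set C ∩ closed-convex-hull{uxu* : u ∈ U(C)} contains exactly one point, where U(C) is the unitary group of C. -/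
set_option maxHeartbeats 1000000
set_option synthInstance.maxHeartbeats 1000000

open scoped ComplexOrder TensorProduct

noncomputable section

section States

variable {B : Type*} [CStarAlgebra B] {φ : B →L[ℂ] ℂ}

/-- A functional that is nonnegative on squares `star a * a`, as a positive linear map for the
spectral order. -/
def positiveOfStarMul (φ : B →L[ℂ] ℂ) (h : ∀ a : B, 0 ≤ φ (star a * a)) :
    letI := CStarAlgebra.spectralOrder B
    B →ₚ[ℂ] ℂ :=
  letI := CStarAlgebra.spectralOrder B
  letI := CStarAlgebra.spectralOrderedRing B
  PositiveLinearMap.mk₀ φ.toLinearMap fun a ha => by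
    obtain ⟨s, rfl⟩ := CStarAlgebra.nonneg_iff_eq_star_mul_self.mp ha
    exact h s

lemma map_star_of_star_mul_nonneg (h : ∀ a : B, 0 ≤ φ (star a * a)) (a : B) :
    φ (star a) = star (φ a) := by
  let := CStarAlgebra.spectralOrder B
  let := CStarAlgebra.spectralOrderedRing B
  exact map_star (positiveOfStarMul φ h) a

lemma norm_sq_le_of_star_mul_nonneg (h : ∀ a : B, 0 ≤ φ (star a * a)) (a b : B) :
    ‖φ (star a * b)‖ ^ 2 ≤ ‖φ (star a * a)‖ * ‖φ (star b * b)‖ := by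
  let := CStarAlgebra.spectralOrder B
  let := CStarAlgebra.spectralOrderedRing B
  let f := positiveOfStarMul φ h
  have key := norm_inner_le_norm (𝕜 := ℂ) (f.toPreGNS a) (f.toPreGNS b)
  have hn : ∀ c : B, ‖f.toPreGNS c‖ ^ 2 = ‖φ (star c * c)‖ := fun c => by
    have := f.preGNS_norm_sq (f.toPreGNS c)
    rw [← Complex.norm_of_nonneg (sq_nonneg ‖f.toPreGNS c‖)]
    push_cast
    rw [this]
    rfl
  have h2 := pow_le_pow_left₀ (norm_nonneg _) key 2
  rw [mul_pow, hn, hn] at h2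
  exact h2

lemma norm_le_of_star_mul_nonneg (h : ∀ a : B, 0 ≤ φ (star a * a)) : ‖φ‖ ≤ ‖φ 1‖ := by
  by_contra! hlt
  have hpos : 0 < ‖φ‖ := (norm_nonneg _).trans_lt hlt
  have hle : ‖φ‖ ≤ √(‖φ 1‖ * ‖φ‖) := by
    refine φ.opNorm_le_bound (Real.sqrt_nonneg _) fun a => ?_
    refine Real.le_sqrt_of_sq_le ?_ |>.trans_eq ?_ (b := √(‖φ 1‖ * ‖φ‖ * ‖a‖ ^ 2))
    · have := norm_sq_le_of_star_mul_nonneg h 1 a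
      simp only [star_one, one_mul] at this
      refine this.trans ?_
      rw [mul_assoc]
      gcongr
      refine (φ.le_opNorm _).trans_eq ?_
      rw [CStarRing.norm_star_mul_self, sq]
    · rw [Real.sqrt_mul (by positivity), Real.sqrt_sq (norm_nonneg _)]
  have := pow_le_pow_left₀ hpos.le hle 2
  rw [Real.sq_sqrt (by positivity)] at this
  nlinarith

lemma isState_iff : IsState φ ↔ φ 1 = 1 ∧ ∀ a : B, 0 ≤ φ (star a * a) := by
  constructor
  · rintro ⟨h1, h⟩
    refine ⟨?_, h⟩
    have : Nontrivial B := by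
      by_contra hB
      rw [not_nontrivial_iff_subsingleton] at hB
      simp [Subsingleton.elim φ 0] at h1
    have h2 := norm_le_of_star_mul_nonneg h
    have h3 : ‖φ 1‖ ≤ 1 := by simpa [h1] using φ.le_opNorm 1
    have h4 : 0 ≤ φ 1 := by simpa using h 1
    have h5 := Complex.norm_of_nonneg' h4
    rw [← h5, le_antisymm h3 (h1 ▸ h2)]
    simp
  · rintro ⟨h1, h⟩
    refine ⟨le_antisymm ?_ ?_, h⟩
    · simpa [h1] using norm_le_of_star_mul_nonneg h
    · have : Nontrivial B := by
        by_contra hB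
        rw [not_nontrivial_iff_subsingleton] at hB
        simp [Subsingleton.elim (1 : B) 0] at h1
      simpa [h1] using φ.le_opNorm 1

lemma IsState.map_one (h : IsState φ) : φ 1 = 1 := (isState_iff.mp h).1

lemma IsState.map_star (h : IsState φ) (a : B) : φ (star a) = star (φ a) :=
  map_star_of_star_mul_nonneg h.2 a

/-- A state is left multiplicative at elements where `star c * c` vanishes on both sides. -/
lemma IsState.map_mul_eq_zero (h : IsState φ) {c : B} (hc : φ (c * star c) = 0) (a : B) :
    φ (c * a) = 0 := by
  have := norm_sq_le_of_star_mul_nonneg h.2 (star c) a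
  simp only [star_star, hc, norm_zero, zero_mul] at this
  simpa using le_antisymm this (sq_nonneg _)

end States

section PureStates

variable {B : Type*} [CStarAlgebra B] {χ : B →L[ℂ] ℂ}

lemma IsState.cutdown (comm : ∀ x y : B, x * y = y * x) (h : IsState χ) {s : B} {r : ℝ}
    (hr : 0 < r) (hs : χ (star s * s) = r) :
    IsState ((r : ℂ)⁻¹ • χ.comp (ContinuousLinearMap.mul ℂ B (star s * s))) := by
  have hr' : (r : ℂ) ≠ 0 := by exact_mod_cast hr.ne'
  refine isState_iff.mpr ⟨by simp [hs, hr'], fun b => ?_⟩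
  have h1 : star s * s * (star b * b) = star (s * b) * (s * b) := by
    rw [star_mul, mul_assoc, mul_assoc, ← mul_assoc s, comm s, ← mul_assoc, ← mul_assoc,
      comm (star s), mul_assoc, mul_assoc]
  have h2 : (0 : ℂ) ≤ (r : ℂ)⁻¹ := by
    rw [← Complex.ofReal_inv]
    exact_mod_cast (inv_pos.mpr hr).le
  simpa [h1] using mul_nonneg h2 (h.2 (s * b))

lemma IsPureState.map_mul_of_sum_one (comm : ∀ x y : B, x * y = y * x) (h : IsPureState χ)
    {s s' : B} (hss : star s * s + star s' * s' = 1) {t : ℝ} (ht0 : 0 < t) (ht1 : t < 1)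
    (ht : χ (star s * s) = t) (b : B) : χ (star s * s * b) = χ (star s * s) * χ b := by
  have ht' : χ (star s' * s') = ((1 - t : ℝ) : ℂ) := by
    rw [← eq_sub_iff_add_eq'] at hss
    rw [hss, map_sub, h.1.map_one, ht]
    simp
  have h0 : (t : ℂ) ≠ 0 := by exact_mod_cast ht0.ne'
  have h1 : ((1 - t : ℝ) : ℂ) ≠ 0 := by exact_mod_cast (sub_pos.mpr ht1).ne'
  have key := (h.2 _ _ t (h.1.cutdown comm ht0 ht) (h.1.cutdown comm (sub_pos.mpr ht1) ht')
    ht0 ht1 ?_).1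
  · have := congrArg (fun f : B →L[ℂ] ℂ => f b) key
    simp only [_root_.smul_apply, ContinuousLinearMap.comp_apply,
      ContinuousLinearMap.mul_apply', smul_eq_mul] at this
    rw [ht, ← this, mul_inv_cancel_left₀ h0]
  · rw [smul_smul, smul_smul, ← Complex.ofReal_one, ← Complex.ofReal_sub, mul_inv_cancel₀ h0,
      mul_inv_cancel₀ h1, one_smul, one_smul]
    ext b
    simp only [_root_.add_apply, ContinuousLinearMap.comp_apply,
      ContinuousLinearMap.mul_apply', ← map_add, ← add_mul, hss, one_mul]

lemma IsPureState.map_mul_of_isSelfAdjoint (comm : ∀ x y : B, x * y = y * x) (h : IsPureState χ)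
    {a : B} (ha : IsSelfAdjoint a) (b : B) : χ (a * b) = χ a * χ b := by
  let := CStarAlgebra.spectralOrder B
  let := CStarAlgebra.spectralOrderedRing B
  set α : ℝ := (2 * (‖a‖ + 1))⁻¹ with hα
  have hα0 : 0 < α := by positivity
  have hα1 : α * ‖a‖ < 1 / 2 := by
    rw [hα, inv_mul_lt_iff₀ (by positivity)]
    linarith
  have hle : α • a ≤ (2⁻¹ : ℝ) • (1 : B) := calc
    α • a ≤ α • (‖a‖ • (1 : B)) := by
      gcongr
      rw [← Algebra.algebraMap_eq_smul_one]
      exact ha.le_algebraMap_norm_self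
    _ = (α * ‖a‖) • (1 : B) := by rw [smul_smul]
    _ ≤ _ := smul_le_smul_of_nonneg_right (by linarith) zero_le_one
  have hge : -((2⁻¹ : ℝ) • (1 : B)) ≤ α • a := by
    rw [neg_le]
    calc
    -(α • a) = α • (-a) := by rw [smul_neg]
    _ ≤ α • (‖a‖ • (1 : B)) := by
      gcongr
      rw [← Algebra.algebraMap_eq_smul_one, neg_le]
      exact ha.neg_algebraMap_norm_le_self
    _ = (α * ‖a‖) • (1 : B) := by rw [smul_smul]
    _ ≤ _ := smul_le_smul_of_nonneg_right (by linarith) zero_le_one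
  obtain ⟨s, hs⟩ := CStarAlgebra.nonneg_iff_eq_star_mul_self.mp (neg_le_iff_add_nonneg.mp hge)
  obtain ⟨s', hs'⟩ := CStarAlgebra.nonneg_iff_eq_star_mul_self.mp (sub_nonneg.mpr hle)
  have hsum : star s * s + star s' * s' = 1 := by
    rw [← hs, ← hs', add_comm (α • a), add_add_sub_cancel, ← add_smul]
    norm_num
  have hre : χ a = (χ a).re := by
    have := h.1.map_star a
    rw [ha.star_eq] at this
    exact (Complex.conj_eq_iff_re.mp this.symm).symm
  have hχa : |(χ a).re| ≤ ‖a‖ := by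
    refine (Complex.abs_re_le_norm _).trans ?_
    simpa [h.1.1] using χ.le_opNorm a
  have hαs : ∀ c : B, χ (α • c) = α * χ c := fun c => by
    rw [← Complex.coe_smul, map_smul, smul_eq_mul]
  have hhs : ∀ c : B, χ ((2⁻¹ : ℝ) • c) = 2⁻¹ * χ c := fun c => by
    rw [← Complex.coe_smul, map_smul, smul_eq_mul]
    simp
  have ht : χ (star s * s) = ((α * (χ a).re + 2⁻¹ : ℝ) : ℂ) := by
    rw [← hs, map_add, hαs, hhs, h.1.map_one, hre]
    simp
  have hb := abs_le.mp hχa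
  have key := h.map_mul_of_sum_one comm hsum (t := α * (χ a).re + 2⁻¹) (by nlinarith)
    (by nlinarith) ht b
  rw [← hs, add_mul, map_add, map_add, smul_mul_assoc, smul_mul_assoc, one_mul, hαs, hhs, hhs,
    hαs, h.1.map_one] at key
  have : (α : ℂ) ≠ 0 := by exact_mod_cast hα0.ne'
  refine mul_left_cancel₀ this ?_
  linear_combination key

/-- Pure states of commutative C⋆-algebras are multiplicative. -/
lemma IsPureState.map_mul (comm : ∀ x y : B, x * y = y * x) (h : IsPureState χ) (a b : B) :
    χ (a * b) = χ a * χ b := by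
  have := realPart_add_I_smul_imaginaryPart a
  rw [← this, add_mul, smul_mul_assoc, map_add, map_add, map_smul, map_smul,
    h.map_mul_of_isSelfAdjoint comm (realPart a).2, h.map_mul_of_isSelfAdjoint comm
    (imaginaryPart a).2]
  simp only [smul_eq_mul]
  ring

lemma isState_of_map_mul (h1 : χ 1 = 1) (hm : ∀ a b, χ (a * b) = χ a * χ b)
    (hs : ∀ a, χ (star a) = star (χ a)) : IsState χ :=
  isState_iff.mpr ⟨h1, fun a => by rw [hm, hs]; exact star_mul_self_nonneg _⟩

/-- Characters are pure states. -/
lemma isPureState_of_map_mul (h1 : χ 1 = 1) (hm : ∀ a b, χ (a * b) = χ a * χ b)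
    (hs : ∀ a, χ (star a) = star (χ a)) : IsPureState χ := by
  refine ⟨isState_of_map_mul h1 hm hs, fun ψ₁ ψ₂ t hψ₁ hψ₂ ht0 ht1 heq => ?_⟩
  have ht0' : (0 : ℂ) < t := by exact_mod_cast ht0
  have ht1' : (0 : ℂ) < 1 - t := by
    rw [← Complex.ofReal_one, ← Complex.ofReal_sub]
    exact_mod_cast sub_pos.mpr ht1
  have hvanish : ∀ a, χ a = 0 → ψ₁ a = 0 ∧ ψ₂ a = 0 := fun a ha => by
    have h0 : χ (star a * a) = 0 := by rw [hm, ha, mul_zero]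
    rw [heq] at h0
    simp only [_root_.add_apply, _root_.smul_apply, smul_eq_mul] at h0
    have h3 := (add_eq_zero_iff_of_nonneg (mul_nonneg ht0'.le (hψ₁.2 a))
      (mul_nonneg ht1'.le (hψ₂.2 a))).mp h0
    have aux : ∀ {ψ : B →L[ℂ] ℂ}, IsState ψ → ψ (star a * a) = 0 → ψ a = 0 := fun hψ h => by
      have := norm_sq_le_of_star_mul_nonneg hψ.2 1 a
      simpa [h] using this
    exact ⟨aux hψ₁ ((mul_eq_zero.mp h3.1).resolve_left ht0'.ne'),
      aux hψ₂ ((mul_eq_zero.mp h3.2).resolve_left ht1'.ne')⟩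
  have hk : ∀ a, χ (a - χ a • 1) = 0 := fun a => by simp [h1]
  constructor
  · ext a
    have := (hvanish _ (hk a)).1
    simpa [hψ₁.map_one, sub_eq_zero] using this
  · ext a
    have := (hvanish _ (hk a)).2
    simpa [hψ₂.map_one, sub_eq_zero] using this

end PureStates

section Extension

variable {A : Type*} [CStarAlgebra A] [PartialOrder A] [StarOrderedRing A]

/-- A real functional that is nonnegative wherever the real part is nonnegative is the real part
of a state. -/
lemma exists_isState_re_eq (g : A →ₗ[ℝ] ℝ) (hg : ∀ a, 0 ≤ (realPart a : A) → 0 ≤ g a)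
    (h1 : g 1 = 1) : ∃ φ : A →L[ℂ] ℂ, IsState φ ∧ ∀ a, (φ a).re = g a := by
  have hbound : ∀ a, g a ≤ ‖a‖ := fun a => by
    have h2 : 0 ≤ (realPart (‖a‖ • (1 : A) - a) : A) := by
      have h3 : (realPart a : A) ≤ ‖a‖ • (1 : A) := by
        refine (realPart a).2.le_algebraMap_norm_self.trans ?_
        rw [← Algebra.algebraMap_eq_smul_one]
        exact algebraMap_mono A (realPart.norm_le a)
      rw [map_sub, AddSubgroupClass.coe_sub, sub_nonneg, map_smul, selfAdjoint.val_smul,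
        (IsSelfAdjoint.one A).coe_realPart]
      exact h3
    have := hg _ h2
    rw [map_sub, map_smul, h1, smul_eq_mul, mul_one] at this
    linarith
  let f : Module.Dual ℂ A := Module.Dual.extendRCLike g
  have hre : ∀ a, (f a).re = g a := fun a => Module.Dual.re_extendRCLike_apply (𝕜 := ℂ) g a
  have hnorm : ∀ a, ‖f a‖ ≤ 1 * ‖a‖ := fun a => by
    rcases eq_or_ne (f a) 0 with h0 | h0
    · simp [h0]
    · have h3 : (f ((star (f a) / ‖f a‖) • a)).re = ‖f a‖ := by
        rw [map_smul, smul_eq_mul, div_mul_eq_mul_div]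
        have h4 : star (f a) * f a = ((‖f a‖ ^ 2 : ℝ) : ℂ) := by
          have := Complex.conj_mul' (f a)
          simpa using this
        have h5 : ‖f a‖ ≠ 0 := norm_ne_zero_iff.mpr h0
        rw [h4, ← Complex.ofReal_div, Complex.ofReal_re]
        field_simp
      rw [← h3, hre]
      refine (hbound _).trans_eq ?_
      have h5 : ‖f a‖ ≠ 0 := norm_ne_zero_iff.mpr h0
      rw [norm_smul, norm_div, norm_star, Complex.norm_real, norm_norm, div_self h5]
  have hpos : ∀ a, 0 ≤ a → 0 ≤ f a := fun a ha => by
    have hsa : IsSelfAdjoint a := .of_nonneg ha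
    rw [Complex.nonneg_iff, hre]
    refine ⟨hg _ (by rwa [hsa.coe_realPart]), ?_⟩
    have h2 : (f a).im = - g (Complex.I • a) := by
      rw [← hre, map_smul]
      simp
    have h3 : (realPart (Complex.I • a) : A) = 0 := by
      rw [realPart_I_smul, hsa.imaginaryPart]
      simp
    have h4 := hg _ h3.ge
    have h5 := hg (-(Complex.I • a)) (by rw [map_neg, NegMemClass.coe_neg, h3, neg_zero])
    rw [map_neg] at h5
    linarith
  refine ⟨f.mkContinuous 1 hnorm, isState_iff.mpr ⟨?_, fun a => hpos _ (star_mul_self_nonneg a)⟩,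
    hre⟩
  have h2 := hpos 1 zero_le_one
  exact (Complex.ext (by simp [hre, h1]) (by simpa using (Complex.nonneg_iff.mp h2).2.symm) :
    f 1 = 1)

variable {C : StarSubalgebra ℂ A} {χ : ↥C →L[ℂ] ℂ}

lemma IsState.re_nonneg_of_realPart_nonneg (hcl : IsClosed (C : Set A)) (hχ : IsState χ) (c : C)
    (hc : 0 ≤ (realPart (c : A) : A)) : 0 ≤ (χ c).re := by
  let d : C := (2⁻¹ : ℂ) • (c + star c)
  have hd : (d : A) = realPart (c : A) := by
    rw [realPart_apply_coe, ← Complex.coe_smul]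
    simp [d]
  have hχd : (χ d).re = (χ c).re := by
    simp [d, hχ.map_star]
    ring
  rw [← hχd]
  rw [← hd] at hc
  have h1 : ‖(‖d‖ : ℂ) • (1 : C) - d‖ ≤ ‖d‖ := by
    have h2 : ‖algebraMap ℝ A ‖(d : A)‖ - (d : A)‖ ≤ ‖algebraMap ℝ A ‖(d : A)‖‖ :=
      CStarAlgebra.norm_le_norm_of_nonneg_of_le
        (sub_nonneg.mpr (IsSelfAdjoint.of_nonneg hc).le_algebraMap_norm_self)
        (sub_le_self _ hc)
    have h3 : ‖algebraMap ℝ A ‖(d : A)‖‖ ≤ ‖(d : A)‖ := by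
      rw [Algebra.algebraMap_eq_smul_one, norm_smul, norm_norm]
      refine mul_le_of_le_one_right (norm_nonneg _) ?_
      cases subsingleton_or_nontrivial A
      · simp [Subsingleton.elim (1 : A) 0]
      · exact CStarRing.norm_one.le
    refine le_trans (le_of_eq ?_) (h2.trans h3)
    rw [Algebra.algebraMap_eq_smul_one, ← Complex.coe_smul]
    rfl
  have h2 := χ.le_opNorm ((‖d‖ : ℂ) • (1 : C) - d)
  rw [hχ.1, one_mul, map_sub, map_smul, hχ.map_one] at h2
  have h3 := (Complex.re_le_norm _).trans (h2.trans h1)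
  simp at h3
  exact h3

/-- The real part of a functional on `C`, as a partially defined real functional on `A`. -/
def rePartialMap (χ : ↥C →L[ℂ] ℂ) : A →ₗ.[ℝ] ℝ where
  domain := C.toSubalgebra.toSubmodule.restrictScalars ℝ
  toFun :=
    { toFun := fun c => (χ ⟨c, c.2⟩).re
      map_add' := fun a b => by rw [← Complex.add_re, ← map_add]; rfl
      map_smul' := fun r a => by
        have : (⟨(r • a : _), (r • a).2⟩ : C) = (r : ℂ) • (⟨a, a.2⟩ : C) :=
          Subtype.ext (Complex.coe_smul r (a : A)).symm
        rw [this, map_smul]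
        simp }

lemma exists_isState_extension_of_le (hcl : IsClosed (C : Set A)) (hχ : IsState χ)
    (f : A →ₗ.[ℝ] ℝ) (hf : rePartialMap χ ≤ f)
    (hpos : ∀ a : f.domain, 0 ≤ (realPart (a : A) : A) → 0 ≤ f a) :
    ∃ φ : A →L[ℂ] ℂ, IsState φ ∧ (∀ c : C, φ c = χ c) ∧ ∀ a : f.domain, (φ a).re = f a := by
  let P : PointedCone ℝ A :=
    { carrier := {a | 0 ≤ (realPart a : A)}
      zero_mem' := by simp
      add_mem' := fun {a b} ha hb => by
        simpa using add_nonneg (show 0 ≤ (realPart a : A) from ha) hb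
      smul_mem' := fun r a (ha : 0 ≤ (realPart a : A)) => by
        have : (r • a) = (r : ℝ) • a := rfl
        show 0 ≤ (realPart (r • a) : A)
        rw [this, map_smul, selfAdjoint.val_smul]
        exact smul_nonneg r.2 ha }
  have hC : ∀ c : C, ∃ h : (c : A) ∈ f.domain, f ⟨c, h⟩ = (χ c).re := fun c =>
    ⟨hf.1 c.2, (hf.2 (x := ⟨c, c.2⟩) (y := ⟨c, hf.1 c.2⟩) rfl).symm⟩
  obtain ⟨g, hg, hgP⟩ := riesz_extension P f hpos fun y => by
    obtain ⟨h, -⟩ := hC (‖y‖ • (1 : C))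
    refine ⟨⟨_, h⟩, ?_⟩
    show 0 ≤ (realPart (((‖y‖ • (1 : C) : C) : A) + y) : A)
    have h2 : ((‖y‖ • (1 : C) : C) : A) = algebraMap ℝ A ‖y‖ := by
      rw [Algebra.algebraMap_eq_smul_one]; rfl
    rw [h2, map_add, AddSubgroup.coe_add, IsSelfAdjoint.coe_realPart (.algebraMap A (.all _)),
      ← neg_le_iff_add_nonneg']
    exact (neg_le_neg (algebraMap_mono A (realPart.norm_le y))).trans
      (realPart y).2.neg_algebraMap_norm_le_self
  have hgC : ∀ c : C, g c = (χ c).re := fun c => by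
    obtain ⟨h, h'⟩ := hC c
    rw [← h', ← hg]
  obtain ⟨φ, hφ, hφg⟩ := exists_isState_re_eq g hgP (by
    simpa [hχ.map_one] using hgC 1)
  refine ⟨φ, hφ, fun c => ?_, fun a => by rw [hφg, hg]⟩
  have hr : ∀ c : C, (φ c).re = (χ c).re := fun c => by rw [hφg, hgC]
  refine Complex.ext (hr c) ?_
  have := hr (Complex.I • c)
  rw [map_smul, show ((Complex.I • c : C) : A) = Complex.I • (c : A) from rfl, map_smul] at this
  simpa using this

lemma IsState.exists_extension (hcl : IsClosed (C : Set A)) (hχ : IsState χ) :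
    ∃ φ : A →L[ℂ] ℂ, IsState φ ∧ ∀ c : C, φ c = χ c := by
  obtain ⟨φ, h1, h2, -⟩ := exists_isState_extension_of_le hcl hχ (rePartialMap χ) le_rfl
    fun a ha => hχ.re_nonneg_of_realPart_nonneg hcl ⟨a, a.2⟩ ha
  exact ⟨φ, h1, h2⟩

lemma IsState.exists_extension_re_eq (hcl : IsClosed (C : Set A)) (hχ : IsState χ) {x : A}
    (hx : IsSelfAdjoint x) (hxC : x ∉ C) {t : ℝ} (hlo : ∀ b : C, (b : A) ≤ x → (χ b).re ≤ t)
    (hhi : ∀ b : C, x ≤ b → t ≤ (χ b).re) :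
    ∃ φ : A →L[ℂ] ℂ, IsState φ ∧ (∀ c : C, φ c = χ c) ∧ (φ x).re = t := by
  let f := (rePartialMap χ).supSpanSingleton x t hxC
  have hfle : rePartialMap χ ≤ f := LinearPMap.left_le_sup _ _ _
  have hfval : ∀ (c : C) (s : ℝ), ∃ h : (c : A) + s • x ∈ f.domain,
      f ⟨(c : A) + s • x, h⟩ = (χ c).re + s * t := fun c s =>
    ⟨_, LinearPMap.supSpanSingleton_apply_mk (rePartialMap χ) x t hxC c c.2 s⟩
  obtain ⟨φ, h1, h2, h3⟩ := exists_isState_extension_of_le hcl hχ f hfle fun a ha => by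
    obtain ⟨a, hadom⟩ := a
    obtain ⟨c, hc, d, hd, rfl⟩ := Submodule.mem_sup.mp hadom
    obtain ⟨s, rfl⟩ := Submodule.mem_span_singleton.mp hd
    obtain ⟨h, hval⟩ := hfval ⟨c, hc⟩ s
    rw [hval]
    let d : C := (2⁻¹ : ℂ) • (⟨c, hc⟩ + star ⟨c, hc⟩)
    have hd : (d : A) = realPart (c : A) := by
      rw [realPart_apply_coe, ← Complex.coe_smul]
      simp [d]
    have hχd : (χ d).re = (χ ⟨c, hc⟩).re := by
      simp [d, hχ.map_star]
      ring
    rw [← hχd]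
    simp only [map_add, AddSubgroup.coe_add, map_smul, selfAdjoint.val_smul, hx.coe_realPart,
      ← hd] at ha
    have hscale : ∀ r : ℝ, (χ (r • d)).re = r * (χ d).re := fun r => by
      rw [← Complex.coe_smul, map_smul]
      simp
    rcases lt_trichotomy s 0 with hs | rfl | hs
    · have h4 : x ≤ ((-s⁻¹ • d : C) : A) := by
        have := smul_le_smul_of_nonneg_left ha (neg_nonneg.mpr (inv_lt_zero.mpr hs).le)
        rw [smul_zero, smul_add, smul_smul, neg_mul, inv_mul_cancel₀ hs.ne, neg_one_smul,
          ← sub_eq_add_neg, sub_nonneg] at this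
        exact this
      have h5 := hhi _ h4
      rw [hscale] at h5
      have h6 := mul_le_mul_of_nonneg_left h5 (neg_nonneg.mpr hs.le)
      rw [← mul_assoc, neg_mul_neg, mul_inv_cancel₀ hs.ne] at h6
      linarith
    · rw [zero_smul, add_zero] at ha
      have := hχ.re_nonneg_of_realPart_nonneg hcl d
        (by rwa [(IsSelfAdjoint.of_nonneg ha).coe_realPart])
      simpa using this
    · have h4 : ((-s⁻¹ • d : C) : A) ≤ x := by
        have := smul_le_smul_of_nonneg_left ha (inv_pos.mpr hs).le
        rw [smul_zero, smul_add, smul_smul, inv_mul_cancel₀ hs.ne', one_smul,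
          ← neg_le_iff_add_nonneg', ← neg_smul] at this
        exact this
      have h5 := hlo _ h4
      rw [hscale] at h5
      have h6 := mul_le_mul_of_nonneg_left h5 hs.le
      rw [← mul_assoc, mul_neg, mul_inv_cancel₀ hs.ne'] at h6
      linarith
  refine ⟨φ, h1, h2, ?_⟩
  obtain ⟨h, hval⟩ := hfval 0 1
  have := h3 ⟨_, h⟩
  rw [hval] at this
  simpa using this

/-- If a state of `C` has only one state extension to `A`, then self-adjoint elements of `A` can be
sandwiched by elements of `C` on which the state takes nearby values. -/
lemma IsState.exists_sandwich (hcl : IsClosed (C : Set A)) (hχ : IsState χ)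
    (huniq : ∀ φ ψ : A →L[ℂ] ℂ, IsState φ → IsState ψ → (∀ c : C, φ c = χ c) →
      (∀ c : C, ψ c = χ c) → φ = ψ) {x : A} (hx : IsSelfAdjoint x) {ε : ℝ} (hε : 0 < ε) :
    ∃ b b' : C, (b : A) ≤ x ∧ x ≤ b' ∧ ‖χ (b' - b)‖ < ε := by
  by_cases hxC : x ∈ C
  · exact ⟨⟨x, hxC⟩, ⟨x, hxC⟩, le_rfl, le_rfl, by simpa using hε⟩
  by_contra! hcon
  have hgap : ∀ b b' : C, (b : A) ≤ x → x ≤ b' → (χ b).re + ε ≤ (χ b').re := fun b b' hb hb' => by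
    have h1 : (0 : A) ≤ ((b' - b : C) : A) := by
      simpa using hb.trans hb'
    have h2 := hχ.re_nonneg_of_realPart_nonneg hcl _
      (by rwa [(IsSelfAdjoint.of_nonneg h1).coe_realPart])
    have h3 : star (b' - b) = b' - b := Subtype.ext (IsSelfAdjoint.of_nonneg h1).star_eq
    have h4 := hχ.map_star (b' - b)
    rw [h3] at h4
    have h5 := hcon b b' hb hb'
    rw [← Complex.conj_eq_iff_re.mp h4.symm, Complex.norm_real, Real.norm_of_nonneg h2, map_sub,
      Complex.sub_re] at h5
    linarith
  let S : Set ℝ := {r | ∃ b : C, (b : A) ≤ x ∧ (χ b).re = r}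
  have hle : x ≤ ((‖x‖ • (1 : C) : C) : A) := by
    have := hx.le_algebraMap_norm_self
    rwa [Algebra.algebraMap_eq_smul_one] at this
  have hge : ((-(‖x‖ • (1 : C)) : C) : A) ≤ x := by
    have := hx.neg_algebraMap_norm_le_self
    rwa [Algebra.algebraMap_eq_smul_one] at this
  have hbdd : BddAbove S := ⟨(χ (‖x‖ • (1 : C))).re, by
    rintro _ ⟨b, hb, rfl⟩
    linarith [hgap b _ hb hle]⟩
  have hne : S.Nonempty := ⟨_, _, hge, rfl⟩
  have hlo : ∀ b : C, (b : A) ≤ x → (χ b).re ≤ sSup S := fun b hb => le_csSup hbdd ⟨b, hb, rfl⟩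
  have hhi : ∀ b : C, x ≤ b → sSup S + ε ≤ (χ b).re := fun b' hb' => by
    rw [← le_sub_iff_add_le]
    refine csSup_le hne ?_
    rintro _ ⟨b, hb, rfl⟩
    linarith [hgap b _ hb hb']
  obtain ⟨φ, hφ, hφχ, hφx⟩ := hχ.exists_extension_re_eq hcl hx hxC hlo
    fun b hb => by linarith [hhi b hb]
  obtain ⟨ψ, hψ, hψχ, hψx⟩ := hχ.exists_extension_re_eq hcl hx hxC (t := sSup S + ε)
    (fun b hb => by linarith [hlo b hb]) hhi
  rw [huniq φ ψ hφ hψ hφχ hψχ, hψx] at hφx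
  linarith

end Extension

section UniqueExtension

variable {A : Type*} [CStarAlgebra A] {C : StarSubalgebra ℂ A}

lemma IsMasaU.isClosed (hC : IsMasaU C) : IsClosed (C : Set A) := by
  have : (C : Set A) = ⋂ c ∈ C, {x | c * x = x * c} := by
    ext x
    simp only [SetLike.mem_coe, Set.mem_iInter, Set.mem_ofPred_eq]
    exact ⟨fun hx c hc => hC.1 c hc x hx, hC.2 x⟩
  rw [this]
  exact isClosed_biInter fun c _ => isClosed_eq (by fun_prop) (by fun_prop)

lemma IsMasaU.comm (hC : IsMasaU C) (x y : C) : x * y = y * x :=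
  Subtype.ext (hC.1 x x.2 y y.2)

/-- Restriction of a functional to a star subalgebra. -/
def restrictFunctional (C : StarSubalgebra ℂ A) (φ : A →L[ℂ] ℂ) : C →L[ℂ] ℂ where
  toLinearMap := φ.toLinearMap.comp C.subtype.toAlgHom.toLinearMap
  cont := φ.continuous.comp continuous_subtype_val

lemma IsState.restrictFunctional (hcl : IsClosed (C : Set A)) {φ : A →L[ℂ] ℂ} (h : IsState φ) :
    IsState (restrictFunctional C φ) :=
  isState_iff.mpr ⟨h.map_one, fun c => h.2 c⟩

lemma IsPureState.of_forall_eq (hcl : IsClosed (C : Set A)) {χ : C →L[ℂ] ℂ}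
    (hχ : IsPureState χ) {φ : A →L[ℂ] ℂ} (hφ : IsState φ) (hφχ : ∀ c : C, φ c = χ c)
    (hext : ∀ ψ₁ ψ₂ : A →L[ℂ] ℂ, ∀ t : ℝ, IsState ψ₁ → IsState ψ₂ → (∀ c : C, ψ₁ c = χ c) →
      (∀ c : C, ψ₂ c = χ c) → 0 < t → t < 1 → φ = (t : ℂ) • ψ₁ + ((1 : ℂ) - (t : ℂ)) • ψ₂ →
      ψ₁ = φ ∧ ψ₂ = φ) : IsPureState φ := by
  refine ⟨hφ, fun ψ₁ ψ₂ t h1 h2 ht0 ht1 heq => ?_⟩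
  obtain ⟨e1, e2⟩ := hχ.2 _ _ t (h1.restrictFunctional hcl) (h2.restrictFunctional hcl) ht0 ht1
    (by
      ext c
      rw [← hφχ, heq]
      rfl)
  exact hext ψ₁ ψ₂ t h1 h2 (fun c => congrArg (fun f : C →L[ℂ] ℂ => f c) e1)
    (fun c => congrArg (fun f : C →L[ℂ] ℂ => f c) e2) ht0 ht1 heq

instance WeakDual.locallyConvexSpace_real : LocallyConvexSpace ℝ (WeakDual ℂ A) :=
  LocallyConvexSpace.induced (𝕜 := ℝ) (F := A → ℂ)
    { toFun := fun (φ : WeakDual ℂ A) (a : A) => φ a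
      map_add' := fun _ _ => rfl
      map_smul' := fun _ _ => rfl }

instance WeakDual.continuousSMul_real : ContinuousSMul ℝ (WeakDual ℂ A) where
  continuous_smul := WeakDual.continuous_of_continuous_eval fun a =>
    continuous_fst.smul ((WeakDual.eval_continuous a).comp continuous_snd)

/-- The weak-* compact convex set of positive functionals extending `χ`. -/
def positiveExtensions (χ : C →L[ℂ] ℂ) : Set (WeakDual ℂ A) :=
  {φ | (∀ a : A, 0 ≤ φ (star a * a)) ∧ ∀ c : C, φ c = χ c}

lemma mem_positiveExtensions_iff {χ : C →L[ℂ] ℂ} (h1 : χ 1 = 1) {φ : WeakDual ℂ A} :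
    φ ∈ positiveExtensions χ ↔
      IsState (WeakDual.toStrongDual φ) ∧ ∀ c : C, WeakDual.toStrongDual φ c = χ c :=
  ⟨fun h => ⟨isState_iff.mpr ⟨(h.2 1).trans h1, h.1⟩, h.2⟩, fun h => ⟨h.1.2, h.2⟩⟩

lemma isCompact_positiveExtensions {χ : C →L[ℂ] ℂ} (h1 : χ 1 = 1) :
    IsCompact (positiveExtensions χ) := by
  refine (WeakDual.isCompact_closedBall (𝕜 := ℂ) (E := A) 0 1).of_isClosed_subset ?_
    fun φ hφ => ?_
  · have : positiveExtensions χ = (⋂ a : A, {φ : WeakDual ℂ A | 0 ≤ φ (star a * a)}) ∩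
        ⋂ c : C, {φ : WeakDual ℂ A | φ c = χ c} := by
      ext φ
      simp [positiveExtensions]
    rw [this]
    exact (isClosed_iInter fun a => isClosed_le continuous_const (WeakDual.eval_continuous _)).inter
      (isClosed_iInter fun c => isClosed_eq (WeakDual.eval_continuous _) continuous_const)
  · simpa using ((mem_positiveExtensions_iff h1).mp hφ).1.1.le

lemma convex_positiveExtensions (χ : C →L[ℂ] ℂ) : Convex ℝ (positiveExtensions χ) := by
  rintro φ ⟨hφ, hφχ⟩ ψ ⟨hψ, hψχ⟩ a b ha hb hab
  have happ : ∀ x, (a • φ + b • ψ) x = (a : ℂ) * φ x + (b : ℂ) * ψ x := fun x => by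
    rw [← smul_eq_mul, ← smul_eq_mul, Complex.coe_smul, Complex.coe_smul]
    rfl
  refine ⟨fun x => ?_, fun c => ?_⟩
  · rw [happ]
    exact add_nonneg (mul_nonneg (by exact_mod_cast ha) (hφ x))
      (mul_nonneg (by exact_mod_cast hb) (hψ x))
  · rw [happ, hφχ, hψχ, ← add_mul, ← Complex.ofReal_add, hab, Complex.ofReal_one, one_mul]

lemma isPureState_of_mem_extremePoints (hcl : IsClosed (C : Set A)) {χ : C →L[ℂ] ℂ}
    (hχ : IsPureState χ) {φ : WeakDual ℂ A} (hφ : φ ∈ (positiveExtensions χ).extremePoints ℝ) :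
    IsPureState (WeakDual.toStrongDual φ) := by
  have h1 := hχ.1.map_one
  rw [mem_extremePoints] at hφ
  obtain ⟨hs, he⟩ := (mem_positiveExtensions_iff h1).mp hφ.1
  refine hχ.of_forall_eq hcl hs he fun ψ₁ ψ₂ t h1' h2' e1 e2 ht0 ht1 heq => ?_
  obtain ⟨r1, r2⟩ := hφ.2 (StrongDual.toWeakDual ψ₁) ((mem_positiveExtensions_iff h1).mpr ⟨h1', e1⟩)
    (StrongDual.toWeakDual ψ₂) ((mem_positiveExtensions_iff h1).mpr ⟨h2', e2⟩)
    ⟨t, 1 - t, ht0, sub_pos.mpr ht1, by ring, by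
      have : φ = StrongDual.toWeakDual ((t : ℂ) • ψ₁ + ((1 : ℂ) - (t : ℂ)) • ψ₂) := by
        rw [← heq]; rfl
      rw [this]
      refine DFunLike.ext _ _ fun a => ?_
      change t • ψ₁ a + (1 - t) • ψ₂ a = (t : ℂ) * ψ₁ a + (1 - (t : ℂ)) * ψ₂ a
      simp [Complex.real_smul]⟩
  exact ⟨r1, r2⟩

/-- If a pure state of `C` has a unique pure state extension, then it has at most one state
extension. -/
lemma IsPureState.eq_of_existsUnique (hcl : IsClosed (C : Set A)) {χ : C →L[ℂ] ℂ}
    (hχ : IsPureState χ)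
    (hE : ∃! φ : A →L[ℂ] ℂ, IsPureState φ ∧ ∀ c : C, φ c = χ c)
    (φ ψ : A →L[ℂ] ℂ) (hφ : IsState φ) (hψ : IsState ψ) (hφχ : ∀ c : C, φ c = χ c)
    (hψχ : ∀ c : C, ψ c = χ c) : φ = ψ := by
  have h1 := hχ.1.map_one
  obtain ⟨φ₀, -, huniq⟩ := hE
  have hsub : (positiveExtensions χ).extremePoints ℝ ⊆ {StrongDual.toWeakDual φ₀} := fun θ hθ =>
    huniq (WeakDual.toStrongDual θ) ⟨isPureState_of_mem_extremePoints hcl hχ hθ, hθ.1.2⟩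
  have hKM := @closure_convexHull_extremePoints (WeakDual ℂ A) _ _ _ _ _
    WeakDual.continuousSMul_real WeakDual.locallyConvexSpace_real _
    (isCompact_positiveExtensions h1) (convex_positiveExtensions χ)
  have hall : ∀ θ : A →L[ℂ] ℂ, IsState θ → (∀ c : C, θ c = χ c) → θ = φ₀ := fun θ hθ hθχ => by
    have hmem : StrongDual.toWeakDual θ ∈ positiveExtensions χ :=
      (mem_positiveExtensions_iff h1).mpr ⟨hθ, hθχ⟩
    rw [← hKM] at hmem
    have := closure_mono (convexHull_mono hsub) hmem
    rwa [convexHull_singleton, closure_singleton] at this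
  rw [hall φ hφ hφχ, hall ψ hψ hψχ]

end UniqueExtension

section Averaging

variable {A : Type*} [CStarAlgebra A] {C : StarSubalgebra ℂ A}

/-- Convex combinations of the maps `x ↦ u * x * star u` for unitaries `u` of `C`. -/
def unitaryAverages (C : StarSubalgebra ℂ A) : Set (A →L[ℂ] A) :=
  convexHull ℝ {T | ∃ u ∈ C, u * star u = 1 ∧ star u * u = 1 ∧
    T = ContinuousLinearMap.mulLeftRight ℂ A u (star u)}

lemma convexHull_conjugates_eq (C : StarSubalgebra ℂ A) (x : A) :
    convexHull ℝ {z : A | ∃ u : A, u ∈ C ∧ u * star u = 1 ∧ star u * u = 1 ∧ z = u * x * star u} =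
      (fun T => T x) '' unitaryAverages C := by
  let ev : (A →L[ℂ] A) →ₗ[ℝ] A :=
    { toFun := fun T => T x
      map_add' := fun _ _ => rfl
      map_smul' := fun _ _ => rfl }
  have h := ev.image_convexHull {T | ∃ u ∈ C, u * star u = 1 ∧ star u * u = 1 ∧
    T = ContinuousLinearMap.mulLeftRight ℂ A u (star u)}
  refine Eq.trans ?_ h.symm
  congr 1
  ext z
  constructor
  · rintro ⟨u, hu, h1, h2, rfl⟩
    exact ⟨_, ⟨u, hu, h1, h2, rfl⟩, by simp [ev]⟩
  · rintro ⟨_, ⟨u, hu, h1, h2, rfl⟩, rfl⟩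
    exact ⟨u, hu, h1, h2, by simp [ev]⟩

lemma mem_closure_conjugates_iff {x y : A} :
    y ∈ closure (convexHull ℝ
      {z : A | ∃ u : A, u ∈ C ∧ u * star u = 1 ∧ star u * u = 1 ∧ z = u * x * star u}) ↔
      ∀ ε > 0, ∃ T ∈ unitaryAverages C, ‖T x - y‖ < ε := by
  rw [convexHull_conjugates_eq, Metric.mem_closure_iff]
  refine forall₂_congr fun ε _ => ?_
  simp [dist_eq_norm, norm_sub_rev y]

lemma unitaryAverages_induction {p : (A →L[ℂ] A) → Prop} (hconv : Convex ℝ {T | p T})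
    (h : ∀ u ∈ C, u * star u = 1 → star u * u = 1 →
      p (ContinuousLinearMap.mulLeftRight ℂ A u (star u)))
    {T : A →L[ℂ] A} (hT : T ∈ unitaryAverages C) : p T :=
  convexHull_min (s := {T | ∃ u ∈ C, u * star u = 1 ∧ star u * u = 1 ∧
    T = ContinuousLinearMap.mulLeftRight ℂ A u (star u)}) (t := {T | p T})
    (by rintro _ ⟨u, hu, h1, h2, rfl⟩; exact h u hu h1 h2) hconv hT

lemma conj_mem_unitaryAverages {u : A} (hu : u ∈ C) (h1 : u * star u = 1) (h2 : star u * u = 1) :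
    ContinuousLinearMap.mulLeftRight ℂ A u (star u) ∈ unitaryAverages C :=
  subset_convexHull _ _ ⟨u, hu, h1, h2, rfl⟩

lemma norm_apply_le_of_mem_unitaryAverages {T : A →L[ℂ] A} (hT : T ∈ unitaryAverages C) (x : A) :
    ‖T x‖ ≤ ‖x‖ := by
  refine unitaryAverages_induction (p := fun T => ‖T x‖ ≤ ‖x‖) ?_ (fun u _ h1 h2 => ?_) hT
  · intro S hS T hT a b ha hb hab
    calc ‖(a • S + b • T) x‖ = ‖a • S x + b • T x‖ := rfl
      _ ≤ a * ‖S x‖ + b * ‖T x‖ := by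
        refine (norm_add_le _ _).trans_eq ?_
        rw [norm_smul, norm_smul, Real.norm_of_nonneg ha, Real.norm_of_nonneg hb]
      _ ≤ a * ‖x‖ + b * ‖x‖ :=
        add_le_add (mul_le_mul_of_nonneg_left hS ha) (mul_le_mul_of_nonneg_left hT hb)
      _ = ‖x‖ := by rw [← add_mul, hab, one_mul]
  · have hu : u ∈ unitary A := Unitary.mem_iff.mpr ⟨h2, h1⟩
    simp [CStarRing.norm_mem_unitary_mul x hu, CStarRing.norm_mul_mem_unitary _ (Unitary.star_mem hu)]

lemma apply_eq_self_of_mem_unitaryAverages (hC : IsMasaU C) {T : A →L[ℂ] A}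
    (hT : T ∈ unitaryAverages C) {c : A} (hc : c ∈ C) : T c = c := by
  refine unitaryAverages_induction (p := fun T => T c = c) ?_ (fun u hu h1 h2 => ?_) hT
  · intro S hS T hT a b ha hb hab
    calc (a • S + b • T) c = a • S c + b • T c := rfl
      _ = a • c + b • c := by rw [hS, hT]
      _ = c := by rw [← add_smul, hab, one_smul]
  · simp [hC.1 u hu c hc, mul_assoc, h1]

lemma commute_of_mem_unitaryAverages (hC : IsMasaU C) {S T : A →L[ℂ] A}
    (hS : S ∈ unitaryAverages C) (hT : T ∈ unitaryAverages C) (x : A) : S (T x) = T (S x) := by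
  refine unitaryAverages_induction (p := fun S => S (T x) = T (S x)) ?_ (fun u hu h1 h2 => ?_) hS
  · intro S hS S' hS' a b ha hb hab
    calc (a • S + b • S') (T x) = a • S (T x) + b • S' (T x) := rfl
      _ = a • T (S x) + b • T (S' x) := by rw [hS, hS']
      _ = T (a • S x + b • S' x) := by
        rw [map_add, ← Complex.coe_smul, ← Complex.coe_smul, ← Complex.coe_smul,
          ← Complex.coe_smul, map_smul, map_smul]
  · refine unitaryAverages_induction (p := fun T => ContinuousLinearMap.mulLeftRight ℂ A u (star u)
      (T x) = T (ContinuousLinearMap.mulLeftRight ℂ A u (star u) x)) ?_ (fun v hv _ _ => ?_) hT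
    · intro S hS S' hS' a b ha hb hab
      simp only [Set.mem_ofPred_eq] at hS hS' ⊢
      calc _ = ContinuousLinearMap.mulLeftRight ℂ A u (star u) (a • S x + b • S' x) := rfl
        _ = a • ContinuousLinearMap.mulLeftRight ℂ A u (star u) (S x) +
            b • ContinuousLinearMap.mulLeftRight ℂ A u (star u) (S' x) := by
          rw [map_add, ← Complex.coe_smul, ← Complex.coe_smul, ← Complex.coe_smul,
            ← Complex.coe_smul, map_smul, map_smul]
        _ = _ := by rw [hS, hS']; rfl
    · have e1 := hC.1 u hu v hv
      have e2 := hC.1 (star u) (star_mem hu) (star v) (star_mem hv)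
      simp only [ContinuousLinearMap.mulLeftRight_apply]
      calc u * (v * x * star v) * star u = (u * v) * x * (star v * star u) := by
            simp only [mul_assoc]
        _ = (v * u) * x * (star u * star v) := by rw [e1, e2]
        _ = _ := by simp only [mul_assoc]

lemma comp_mem_unitaryAverages {S T : A →L[ℂ] A}
    (hS : S ∈ unitaryAverages C) (hT : T ∈ unitaryAverages C) : S.comp T ∈ unitaryAverages C := by
  refine unitaryAverages_induction (p := fun S => S.comp T ∈ unitaryAverages C) ?_
    (fun u hu h1 h2 => ?_) hS
  · intro S hS S' hS' a b ha hb hab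
    exact convex_convexHull ℝ _ hS hS' ha hb hab
  · refine unitaryAverages_induction (p := fun T =>
      (ContinuousLinearMap.mulLeftRight ℂ A u (star u)).comp T ∈ unitaryAverages C) ?_
      (fun v hv h3 h4 => ?_) hT
    · intro S hS S' hS' a b ha hb hab
      have := convex_convexHull ℝ _ hS hS' ha hb hab
      have e : (ContinuousLinearMap.mulLeftRight ℂ A u (star u)).comp (a • S + b • S') =
          a • (ContinuousLinearMap.mulLeftRight ℂ A u (star u)).comp S +
          b • (ContinuousLinearMap.mulLeftRight ℂ A u (star u)).comp S' := by
        ext x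
        change ContinuousLinearMap.mulLeftRight ℂ A u (star u) (a • S x + b • S' x) =
          a • ContinuousLinearMap.mulLeftRight ℂ A u (star u) (S x) +
            b • ContinuousLinearMap.mulLeftRight ℂ A u (star u) (S' x)
        rw [map_add, ← Complex.coe_smul, ← Complex.coe_smul, ← Complex.coe_smul,
          ← Complex.coe_smul, map_smul, map_smul]
      rw [Set.mem_ofPred_eq, e]
      exact this
    · have := conj_mem_unitaryAverages (mul_mem hu hv)
        (by rw [star_mul, mul_assoc, ← mul_assoc v, h3, one_mul, h1])
        (by rw [star_mul, mul_assoc, ← mul_assoc (star u), h2, one_mul, h4])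
      convert this using 1
      ext x
      simp [mul_assoc]

/-- The elements that can be averaged to zero by unitaries of `C`. -/
def averagesToZero (hC : IsMasaU C) : Submodule ℂ A where
  carrier := {x | ∀ ε > 0, ∃ T ∈ unitaryAverages C, ‖T x‖ < ε}
  zero_mem' := fun ε hε => ⟨_, conj_mem_unitaryAverages C.one_mem (by simp) (by simp), by simpa⟩
  add_mem' := fun {x y} hx hy ε hε => by
    obtain ⟨S, hS, hSx⟩ := hx (ε / 2) (half_pos hε)
    obtain ⟨T, hT, hTy⟩ := hy (ε / 2) (half_pos hε)
    refine ⟨T.comp S, comp_mem_unitaryAverages hT hS, ?_⟩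
    rw [map_add]
    refine (norm_add_le _ _).trans_lt ?_
    have h1 := norm_apply_le_of_mem_unitaryAverages hT (S x)
    have h2 := norm_apply_le_of_mem_unitaryAverages hS (T y)
    rw [← commute_of_mem_unitaryAverages hC hT hS] at h2
    simp only [ContinuousLinearMap.comp_apply]
    linarith
  smul_mem' := fun r x hx ε hε => by
    obtain ⟨T, hT, hTx⟩ := hx (ε / (‖r‖ + 1)) (by positivity)
    refine ⟨T, hT, ?_⟩
    rw [map_smul, norm_smul]
    rw [lt_div_iff₀ (by positivity)] at hTx
    nlinarith [norm_nonneg (T x)]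

lemma isClosed_averagesToZero (hC : IsMasaU C) : IsClosed (averagesToZero hC : Set A) := by
  refine isClosed_of_closure_subset fun x hx ε hε => ?_
  obtain ⟨y, hy, hxy⟩ := Metric.mem_closure_iff.mp hx (ε / 2) (half_pos hε)
  obtain ⟨T, hT, hTy⟩ := hy (ε / 2) (half_pos hε)
  refine ⟨T, hT, ?_⟩
  have h1 := norm_apply_le_of_mem_unitaryAverages hT (x - y)
  rw [dist_eq_norm] at hxy
  have h2 : T x = T (x - y) + T y := by simp
  rw [h2]
  exact (norm_add_le _ _).trans_lt (by linarith)

lemma conj_sub_mem_averagesToZero (hC : IsMasaU C) {u : A} (hu : u ∈ C) (h1 : u * star u = 1)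
    (h2 : star u * u = 1) (b : A) : u * b * star u - b ∈ averagesToZero hC := by
  intro ε hε
  obtain ⟨n, hn⟩ := exists_nat_gt (2 * ‖b‖ / ε)
  let N := n + 1
  let P : ℕ → A →L[ℂ] A := fun k => ContinuousLinearMap.mulLeftRight ℂ A (u ^ k) (star (u ^ k))
  have hU : u ∈ unitary A := Unitary.mem_iff.mpr ⟨h2, h1⟩
  have hUk : ∀ k, u ^ k ∈ unitary A := fun k => pow_mem hU k
  have hP : ∀ k, P k ∈ unitaryAverages C := fun k =>
    conj_mem_unitaryAverages (pow_mem hu k) (Unitary.mem_iff.mp (hUk k)).2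
      (Unitary.mem_iff.mp (hUk k)).1
  have hN : (0 : ℝ) < N := by positivity
  refine ⟨∑ k ∈ Finset.range N, (N : ℝ)⁻¹ • P k, ?_, ?_⟩
  · refine (convex_convexHull ℝ _).sum_mem (fun _ _ => by positivity) ?_ fun k _ => hP k
    rw [Finset.sum_const, Finset.card_range, nsmul_eq_mul, mul_inv_cancel₀ hN.ne']
  · have hstep : ∀ k, P k (u * b * star u - b) = P (k + 1) b - P k b := fun k => by
      simp only [P, map_sub, ContinuousLinearMap.mulLeftRight_apply, pow_succ, star_mul, mul_assoc]
    have e : (∑ k ∈ Finset.range N, (N : ℝ)⁻¹ • P k) (u * b * star u - b) =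
        (N : ℝ)⁻¹ • (P N b - P 0 b) := by
      rw [← Finset.smul_sum]
      change (N : ℝ)⁻¹ • ((∑ k ∈ Finset.range N, P k) (u * b * star u - b)) = _
      rw [sum_apply, Finset.sum_congr rfl fun k _ => hstep k,
        Finset.sum_range_sub fun k => P k b]
    rw [e, norm_smul, norm_inv, Real.norm_of_nonneg hN.le, inv_mul_lt_iff₀ hN]
    have h3 : ‖P N b - P 0 b‖ ≤ 2 * ‖b‖ := by
      refine (norm_sub_le _ _).trans ?_
      linarith [norm_apply_le_of_mem_unitaryAverages (hP N) b,
        norm_apply_le_of_mem_unitaryAverages (hP 0) b]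
    rw [div_lt_iff₀ hε] at hn
    refine h3.trans_lt (hn.trans ?_)
    gcongr
    simp [N]

lemma commutator_mem_averagesToZero (hC : IsMasaU C) (c : C) (a : A) :
    c * a - a * c ∈ averagesToZero hC := by
  have : IsClosed (C : Set A) := hC.isClosed
  have hc : c ∈ Submodule.span ℂ (unitary C : Set C) := by
    rw [CStarAlgebra.span_unitary C]
    trivial
  induction hc using Submodule.span_induction with
  | mem u hu =>
    have h1 : (u : A) * star (u : A) = 1 := congrArg Subtype.val (Unitary.mem_iff.mp hu).2
    have h2 : star (u : A) * (u : A) = 1 := congrArg Subtype.val (Unitary.mem_iff.mp hu).1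
    have := conj_sub_mem_averagesToZero hC u.2 h1 h2 (a * u)
    rwa [← mul_assoc, mul_assoc, h1, mul_one] at this
  | zero => simp
  | add x y _ _ hx hy =>
    have := add_mem hx hy
    rw [sub_add_sub_comm, ← add_mul, ← mul_add] at this
    exact this
  | smul r x _ hx =>
    have := Submodule.smul_mem _ r hx
    rw [smul_sub, ← smul_mul_assoc, ← mul_smul_comm] at this
    exact this

/-- Decompositions into an element of `C` and one that averages to zero pass to limits. -/
lemma exists_sub_mem_averagesToZero_of_approx (hC : IsMasaU C) {x : A}
    (h : ∀ ε > 0, ∃ c ∈ C, ∃ v ∈ averagesToZero hC, ‖x - (c + v)‖ < ε) :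
    ∃ c ∈ C, x - c ∈ averagesToZero hC := by
  have hcontr : ∀ c ∈ C, ∀ v ∈ averagesToZero hC, ‖c‖ ≤ ‖c + v‖ := fun c hc v hv => by
    refine le_of_forall_pos_lt_add fun ε hε => ?_
    obtain ⟨T, hT, hTv⟩ := hv ε hε
    have h1 := norm_apply_le_of_mem_unitaryAverages hT (c + v)
    rw [map_add, apply_eq_self_of_mem_unitaryAverages hC hT hc] at h1
    have h2 := norm_sub_le (c + T v) (T v)
    rw [add_sub_cancel_right] at h2
    linarith
  choose c hc v hv hcv using fun n : ℕ => h (1 / ((n : ℝ) + 1)) Nat.one_div_pos_of_nat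
  have hlim : Filter.Tendsto (fun n => c n + v n) Filter.atTop (nhds x) := by
    rw [tendsto_iff_norm_sub_tendsto_zero]
    refine squeeze_zero (fun _ => norm_nonneg _) (fun n => ?_) tendsto_one_div_add_atTop_nhds_zero_nat
    rw [norm_sub_rev]
    exact (hcv n).le
  have hcauchy : CauchySeq c := by
    rw [Metric.cauchySeq_iff]
    intro ε hε
    obtain ⟨N, hN⟩ := Metric.cauchySeq_iff.mp hlim.cauchySeq ε hε
    refine ⟨N, fun m hm n hn => lt_of_le_of_lt ?_ (hN m hm n hn)⟩
    rw [dist_eq_norm, dist_eq_norm, add_sub_add_comm]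
    exact hcontr _ (sub_mem (hc m) (hc n)) _ (sub_mem (hv m) (hv n))
  obtain ⟨c₀, hc₀⟩ := cauchySeq_tendsto_of_complete hcauchy
  refine ⟨c₀, hC.isClosed.mem_of_tendsto hc₀ (Filter.Eventually.of_forall hc), ?_⟩
  refine (isClosed_averagesToZero hC).mem_of_tendsto (hlim.sub hc₀)
    (Filter.Eventually.of_forall fun n => ?_)
  simpa using hv n

lemma eq_of_mem_closure_conjugates (hC : IsMasaU C) {x y y' : A} (hy : y ∈ C) (hy' : y' ∈ C)
    (h : ∀ ε > 0, ∃ T ∈ unitaryAverages C, ‖T x - y‖ < ε)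
    (h' : ∀ ε > 0, ∃ T ∈ unitaryAverages C, ‖T x - y'‖ < ε) : y = y' := by
  rw [← sub_eq_zero, ← norm_eq_zero]
  refine le_antisymm (le_of_forall_pos_le_add fun ε hε => ?_) (norm_nonneg _)
  obtain ⟨S, hS, hSx⟩ := h (ε / 2) (half_pos hε)
  obtain ⟨T, hT, hTx⟩ := h' (ε / 2) (half_pos hε)
  have h1 := norm_apply_le_of_mem_unitaryAverages hT (S x - y)
  have h2 := norm_apply_le_of_mem_unitaryAverages hS (T x - y')
  rw [map_sub, apply_eq_self_of_mem_unitaryAverages hC hT hy] at h1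
  rw [map_sub, apply_eq_self_of_mem_unitaryAverages hC hS hy',
    commute_of_mem_unitaryAverages hC hS hT] at h2
  have h3 := norm_sub_le (T (S x) - y') (T (S x) - y)
  rw [sub_sub_sub_cancel_left] at h3
  linarith

end Averaging

section Partition

open WeakDual

lemma exists_partition_norm_le_of_commCStarAlgebra {B : Type*} [CommCStarAlgebra B] {ε : ℝ}
    (hε : 0 < ε) (d : characterSpace ℂ B → B) (hd : ∀ χ : characterSpace ℂ B, ‖χ (d χ)‖ < ε) :
    ∃ (t : Finset (characterSpace ℂ B)) (F : characterSpace ℂ B → B),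
      (∀ i, IsSelfAdjoint (F i)) ∧ ∑ i ∈ t, F i * F i = 1 ∧ ‖∑ i ∈ t, F i * d i * F i‖ ≤ ε := by
  let X := characterSpace ℂ B
  let G := gelfandStarTransform B
  have hcont : ∀ i : X, Continuous fun χ : X => ‖χ (d i)‖ := fun i => (map_continuous (G (d i))).norm
  obtain ⟨t, ht⟩ := isCompact_univ.elim_finite_subcover (fun i : X => {χ : X | ‖χ (d i)‖ < ε})
    (fun i => isOpen_lt (hcont i) continuous_const)
    (fun χ _ => Set.mem_iUnion.mpr ⟨χ, hd χ⟩)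
  let h : X → X → ℝ := fun i χ => max (ε - ‖χ (d i)‖) 0
  let H : X → ℝ := fun χ => ∑ i ∈ t, h i χ
  have hh : ∀ i, Continuous (h i) := fun i => (continuous_const.sub (hcont i)).max continuous_const
  have hh0 : ∀ i χ, 0 ≤ h i χ := fun i χ => le_max_right _ _
  have hH : ∀ χ, 0 < H χ := fun χ => by
    obtain ⟨i, hi, hχ⟩ := Set.mem_iUnion₂.mp (ht (Set.mem_univ χ))
    exact Finset.sum_pos' (fun i _ => hh0 i χ) ⟨i, hi, lt_max_of_lt_left (sub_pos.mpr hχ)⟩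
  have hHc : Continuous H := continuous_finsetSum _ fun i _ => hh i
  let f : X → C(X, ℂ) := fun i =>
    ⟨fun χ => (√(h i χ / H χ) : ℝ), Complex.continuous_ofReal.comp
      ((hh i).div hHc fun χ => (hH χ).ne').sqrt⟩
  have hff : ∀ i χ, f i χ * f i χ = ((h i χ / H χ : ℝ) : ℂ) := fun i χ => by
    change ((√(h i χ / H χ) : ℝ) : ℂ) * ((√(h i χ / H χ) : ℝ) : ℂ) = _
    rw [← Complex.ofReal_mul, Real.mul_self_sqrt (div_nonneg (hh0 i χ) (hH χ).le)]
  have hsum : ∀ χ, ∑ i ∈ t, h i χ / H χ = 1 := fun χ => by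
    rw [← Finset.sum_div, div_self (hH χ).ne']
  have hG : ∀ i, G (G.symm (f i)) = f i := fun i => G.apply_symm_apply (f i)
  refine ⟨t, fun i => G.symm (f i), fun i => ?_, ?_, ?_⟩
  · have : IsSelfAdjoint (f i) := by
      ext χ
      exact Complex.conj_ofReal _
    exact this.map G.symm
  · refine EquivLike.injective G ?_
    rw [map_sum, map_one]
    ext χ
    rw [ContinuousMap.sum_apply]
    simp only [map_mul, hG, ContinuousMap.mul_apply, hff, ContinuousMap.one_apply]
    rw [← Complex.ofReal_sum, hsum, Complex.ofReal_one]
  · have hiso : Isometry G := gelfandTransform_isometry B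
    rw [← hiso.norm_map_of_map_zero (map_zero G), ContinuousMap.norm_le _ hε.le]
    intro χ
    simp only [map_sum, map_mul, hG]
    rw [ContinuousMap.sum_apply]
    calc ‖∑ i ∈ t, (f i * G (d i) * f i) χ‖ ≤ ∑ i ∈ t, h i χ / H χ * ε := by
          refine norm_sum_le_of_le _ fun i _ => ?_
          simp only [ContinuousMap.mul_apply]
          rw [mul_right_comm, hff, norm_mul, Complex.norm_real,
            Real.norm_of_nonneg (div_nonneg (hh0 i χ) (hH χ).le), div_mul_eq_mul_div,
            div_mul_eq_mul_div]
          refine div_le_div_of_nonneg_right ?_ (hH χ).le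
          · change h i χ * ‖χ (d i)‖ ≤ _
            rcases le_total ‖χ (d i)‖ ε with hle | hle
            · exact mul_le_mul_of_nonneg_left hle (hh0 i χ)
            · have : h i χ = 0 := max_eq_right (sub_nonpos.mpr hle)
              simp [this]
      _ = ε := by rw [← Finset.sum_mul, hsum, one_mul]

lemma exists_partition_norm_le {B : Type*} [CStarAlgebra B] (comm : ∀ x y : B, x * y = y * x)
    {ε : ℝ} (hε : 0 < ε) (d : characterSpace ℂ B → B)
    (hd : ∀ χ : characterSpace ℂ B, ‖χ (d χ)‖ < ε) :
    ∃ (t : Finset (characterSpace ℂ B)) (F : characterSpace ℂ B → B),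
      (∀ i, IsSelfAdjoint (F i)) ∧ ∑ i ∈ t, F i * F i = 1 ∧ ‖∑ i ∈ t, F i * d i * F i‖ ≤ ε :=
  letI : CommCStarAlgebra B := { ‹CStarAlgebra B› with mul_comm := comm }
  exists_partition_norm_le_of_commCStarAlgebra hε d hd

end Partition

section Main

variable {A : Type*} [CStarAlgebra A] {C : StarSubalgebra ℂ A}

lemma isPureState_of_mem_characterSpace {B : Type*} [CStarAlgebra B]
    (χ : WeakDual.characterSpace ℂ B) :
    IsPureState (WeakDual.CharacterSpace.toCLM χ) :=
  isPureState_of_map_mul (map_one χ) (map_mul χ) (map_star χ)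

/-- Under the extension property, a self-adjoint element is close to the sum of an element of `C`
and one that averages to zero. -/
lemma HasExtensionPropertyU.exists_norm_sub_lt (hE : HasExtensionPropertyU C) (hC : IsMasaU C)
    {x : A} (hx : IsSelfAdjoint x) {ε : ℝ} (hε : 0 < ε) :
    ∃ c ∈ C, ∃ v ∈ averagesToZero hC, ‖x - (c + v)‖ < ε := by
  have hcl : IsClosed (C : Set A) := hC.isClosed
  let := CStarAlgebra.spectralOrder A
  let := CStarAlgebra.spectralOrderedRing A
  have hsand : ∀ χ : WeakDual.characterSpace ℂ C, ∃ b b' : C, (b : A) ≤ x ∧ x ≤ b' ∧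
      ‖χ (b' - b)‖ < ε / 2 := fun χ =>
    have hχ := isPureState_of_mem_characterSpace χ
    hχ.1.exists_sandwich hcl (hχ.eq_of_existsUnique hcl (hE _ hχ)) hx (half_pos hε)
  choose b b' hb hb' hbb using hsand
  obtain ⟨t, F, hF, hF1, hFd⟩ :=
    exists_partition_norm_le hC.comm (half_pos hε) (fun χ => b' χ - b χ) hbb
  have hFA : ∀ i, IsSelfAdjoint (F i : A) := fun i => congrArg Subtype.val (hF i)
  let Φ : A → A := fun a => ∑ i ∈ t, (F i : A) * a * F i
  let B : C := ∑ i ∈ t, F i * b i * F i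
  let B' : C := ∑ i ∈ t, F i * b' i * F i
  have hle : (B : A) ≤ Φ x := by
    simp only [B, Φ, AddSubmonoidClass.coe_finsetSum, MulMemClass.coe_mul]
    exact Finset.sum_le_sum fun i _ => (hFA i).conjugate_le_conjugate (hb i)
  have hle' : Φ x ≤ B' := by
    simp only [B', Φ, AddSubmonoidClass.coe_finsetSum, MulMemClass.coe_mul]
    exact Finset.sum_le_sum fun i _ => (hFA i).conjugate_le_conjugate (hb' i)
  have hnorm : ‖Φ x - B‖ ≤ ε / 2 := by
    refine (CStarAlgebra.norm_le_norm_of_nonneg_of_le (sub_nonneg.mpr hle)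
      (sub_le_sub_right hle' _)).trans ?_
    refine le_trans (le_of_eq ?_) hFd
    change ‖B' - B‖ = _
    simp only [B, B', ← Finset.sum_sub_distrib, mul_sub, sub_mul]
  have hFsum : ∑ i ∈ t, (F i : A) * F i = 1 := by
    simpa using congrArg Subtype.val hF1
  refine ⟨B, B.2, x - Φ x, ?_, ?_⟩
  · have : x - Φ x = ∑ i ∈ t, ((F i : A) * (F i * x) - F i * x * F i) := by
      rw [Finset.sum_sub_distrib]
      simp only [← mul_assoc]
      rw [← Finset.sum_mul, hFsum, one_mul]
    rw [this]
    exact sum_mem fun i _ => commutator_mem_averagesToZero hC (F i) (F i * x)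
  · rw [add_comm, sub_add_eq_sub_sub, sub_sub_cancel]
    exact hnorm.trans_lt (half_lt_self hε)

lemma HasExtensionPropertyU.exists_sub_mem_averagesToZero (hE : HasExtensionPropertyU C)
    (hC : IsMasaU C) (x : A) : ∃ c ∈ C, x - c ∈ averagesToZero hC := by
  have hsa : ∀ y : A, IsSelfAdjoint y → ∃ c ∈ C, y - c ∈ averagesToZero hC := fun y hy =>
    exists_sub_mem_averagesToZero_of_approx hC fun ε hε => hE.exists_norm_sub_lt hC hy hε
  obtain ⟨c, hc, hxc⟩ := hsa (realPart x) (realPart x).2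
  obtain ⟨d, hd, hxd⟩ := hsa (imaginaryPart x) (imaginaryPart x).2
  refine ⟨c + Complex.I • d, add_mem hc (C.smul_mem hd _), ?_⟩
  have := add_mem hxc (Submodule.smul_mem _ Complex.I hxd)
  rwa [smul_sub, sub_add_sub_comm, realPart_add_I_smul_imaginaryPart] at this

/-- A state restricting to a character of `C` is invariant under averaging by unitaries of `C`. -/
lemma IsState.apply_eq_of_mem_unitaryAverages (hC : IsMasaU C) {χ : C →L[ℂ] ℂ}
    (hχ : IsPureState χ) {φ : A →L[ℂ] ℂ} (hφ : IsState φ) (hφχ : ∀ c : C, φ c = χ c)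
    {T : A →L[ℂ] A} (hT : T ∈ unitaryAverages C) (x : A) : φ (T x) = φ x := by
  have hcl : IsClosed (C : Set A) := hC.isClosed
  have hmulχ : ∀ a b : C, χ (a * b) = χ a * χ b := hχ.map_mul hC.comm
  have hleft : ∀ (c : C) (a : A), φ (c * a) = χ c * φ a := fun c a => by
    let e : C := c - χ c • 1
    have he : χ e = 0 := by simp [e, hχ.1.map_one]
    have h0 : φ ((e : A) * star (e : A)) = 0 := by
      have := hφχ (e * star e)
      rwa [hmulχ, he, zero_mul] at this
    have := hφ.map_mul_eq_zero h0 a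
    have h1 : (e : A) * a = c * a - χ c • a := by
      change ((c : A) - χ c • (1 : A)) * a = _
      rw [sub_mul, smul_mul_assoc, one_mul]
    rwa [h1, map_sub, map_smul, smul_eq_mul, sub_eq_zero] at this
  have hright : ∀ (c : C) (a : A), φ (a * c) = φ a * χ c := fun c a => by
    have h1 := hleft (star c) (star a)
    have h2 : ((star c : C) : A) * star a = star (a * c) := by simp
    rw [h2, hφ.map_star, hφ.map_star, hχ.1.map_star, ← star_mul'] at h1
    rw [star_injective h1, mul_comm]
  refine unitaryAverages_induction (p := fun T => φ (T x) = φ x) ?_ (fun u hu h1 _ => ?_) hT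
  · intro S hS T hT a b ha hb hab
    calc φ ((a • S + b • T) x) = φ (a • S x + b • T x) := rfl
      _ = (a : ℂ) * φ (S x) + (b : ℂ) * φ (T x) := by
        rw [map_add, ← Complex.coe_smul, ← Complex.coe_smul, map_smul, map_smul, smul_eq_mul,
          smul_eq_mul]
      _ = φ x := by rw [hS, hT, ← add_mul, ← Complex.ofReal_add, hab, Complex.ofReal_one, one_mul]
  · let v : C := ⟨u, hu⟩
    have hv : v * star v = 1 := Subtype.ext h1
    have e1 : φ (u * x * star u) = χ v * φ x * χ (star v) := by
      rw [← hleft v x]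
      exact hright (star v) (u * x)
    rw [ContinuousLinearMap.mulLeftRight_apply, e1, mul_right_comm, ← hmulχ, hv, hχ.1.map_one,
      one_mul]

lemma IsState.apply_eq_of_approx (hC : IsMasaU C) {χ : C →L[ℂ] ℂ}
    (hχ : IsPureState χ) {φ : A →L[ℂ] ℂ} (hφ : IsState φ) (hφχ : ∀ c : C, φ c = χ c) {x y : A}
    (h : ∀ ε > 0, ∃ T ∈ unitaryAverages C, ‖T x - y‖ < ε) : φ x = φ y := by
  rw [← sub_eq_zero, ← norm_eq_zero]
  refine le_antisymm (le_of_forall_pos_le_add fun ε hε => ?_) (norm_nonneg _)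
  obtain ⟨T, hT, hTx⟩ := h ε hε
  rw [← hφ.apply_eq_of_mem_unitaryAverages hC hχ hφχ hT, ← map_sub, zero_add]
  have := φ.le_opNorm (T x - y)
  rw [hφ.1, one_mul] at this
  exact this.trans hTx.le

end Main

/-- Archbold's characterization: a masa `C` of a unital C*-algebra has
the extension property iff for every `x ∈ A` the set
`C ∩ co{u x u* : u ∈ U(C)}` is a singleton. -/
theorem stmt_18 {A : Type*} [CStarAlgebra A] (C : StarSubalgebra ℂ A) (hC : IsMasaU C) :
    HasExtensionPropertyU C ↔
    ∀ x : A, ∃! y : A, y ∈ (C : Set A) ∩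
      closure (convexHull ℝ
        {z : A | ∃ u : A, u ∈ C ∧ u * star u = 1 ∧ star u * u = 1 ∧ z = u * x * star u}) := by
  constructor
  · intro hE x
    obtain ⟨c, hc, hxc⟩ := hE.exists_sub_mem_averagesToZero hC x
    have happ : ∀ ε > 0, ∃ T ∈ unitaryAverages C, ‖T x - c‖ < ε := fun ε hε => by
      obtain ⟨T, hT, hTx⟩ := hxc ε hε
      rw [map_sub, apply_eq_self_of_mem_unitaryAverages hC hT hc] at hTx
      exact ⟨T, hT, hTx⟩
    exact ⟨c, ⟨hc, mem_closure_conjugates_iff.mpr happ⟩, fun y hy =>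
      eq_of_mem_closure_conjugates hC hy.1 hc (mem_closure_conjugates_iff.mp hy.2) happ⟩
  · intro h χ hχ
    have hcl : IsClosed (C : Set A) := hC.isClosed
    let := CStarAlgebra.spectralOrder A
    let := CStarAlgebra.spectralOrderedRing A
    have huniq : ∀ φ ψ : A →L[ℂ] ℂ, IsState φ → IsState ψ → (∀ c : C, φ c = χ c) →
        (∀ c : C, ψ c = χ c) → φ = ψ := fun φ ψ hφ hψ hφχ hψχ => by
      ext x
      obtain ⟨y, ⟨hy, hxy⟩, -⟩ := h x
      rw [mem_closure_conjugates_iff] at hxy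
      rw [hφ.apply_eq_of_approx hC hχ hφχ hxy, hψ.apply_eq_of_approx hC hχ hψχ hxy]
      exact (hφχ ⟨y, hy⟩).trans (hψχ ⟨y, hy⟩).symm
    obtain ⟨φ, hφ, hφχ⟩ := hχ.1.exists_extension hcl
    refine ⟨φ, ⟨?_, hφχ⟩, fun ψ hψ => huniq ψ φ hψ.1.1 hφ hψ.2 hφχ⟩
    exact hχ.of_forall_eq hcl hφ hφχ fun ψ₁ ψ₂ _ h1 h2 e1 e2 _ _ _ =>
      ⟨huniq ψ₁ φ h1 hφ e1 hφχ, huniq ψ₂ φ h2 hφ e2 hφχ⟩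
end
end
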